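/- arXiv:1006.2561 — 4 statements merged into one kernel-verified Lean document; each statement's English description precedes it below -/
import Mathlib

section
/- Let P be a finite graded poset of rank d with 0̂ and 1̂ admitting an EL-labeling λ. Then the order complex Δ(P) (whose faces are the chains of P ∖ {0̂, 1̂}) is shellable: there is an ordering F_1, …, F_t of the maximal chains of P ∖ {0̂, 1̂} such that for all j < k there exists j′ < k with F_j ∩ F_k ⊆ F_{j′} ∩ F_k = F_{j′} − x for some element x of F_{j′}. -/
/-- The label word of a chain, listed as a list of elements: the list of labels of
consecutive (covering) pairs. -/
def chainWord {α : Type*} (lab : α → α → ℤ) (l : List α) : List ℤ :=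
  (l.zip l.tail).map fun p => lab p.1 p.2

/-- `l` is a saturated chain from `x` to `y`: a list `x = x_0 ⋖ x_1 ⋖ ⋯ ⋖ x_t = y`. -/
def IsSatChain {α : Type*} [PartialOrder α] (x y : α) (l : List α) : Prop :=
  l.Chain' (· ⋖ ·) ∧ l.head? = some x ∧ l.getLast? = some y

/-- `lab` is an EL-labeling: every interval `[x,y]` has a unique saturated chain with
strictly increasing label, and this label lexicographically (strictly) precedes the label
of every other saturated chain of `[x,y]`. -/
def IsELLabeling {α : Type*} [PartialOrder α] (lab : α → α → ℤ) : Prop :=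
  ∀ x y : α, x ≤ y →
    (∃! l : List α, IsSatChain x y l ∧ (chainWord lab l).Chain' (· < ·)) ∧
    ∀ l l' : List α, IsSatChain x y l → (chainWord lab l).Chain' (· < ·) →
      IsSatChain x y l' → l' ≠ l →
      List.Lex (· < ·) (chainWord lab l) (chainWord lab l')

/-- An `S_d`-EL-labeling of a bounded poset: an EL-labeling in which the label of every
maximal chain is a permutation of `[d] = {1,…,d}`. -/
def IsSdELLabeling {α : Type*} [PartialOrder α] [BoundedOrder α] (d : ℕ)
    (lab : α → α → ℤ) : Prop :=
  IsELLabeling lab ∧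
    ∀ l : List α, IsSatChain (⊥ : α) (⊤ : α) l →
      (chainWord lab l).Perm ((List.range d).map fun i => (i : ℤ) + 1)

/-- The facet of the order complex `Δ(P)` corresponding to a maximal chain `l` of `P`:
the set of its elements with `⊥ = 0̂` and `⊤ = 1̂` removed. -/
def chainFacet {α : Type*} [PartialOrder α] [BoundedOrder α] [DecidableEq α]
    (l : List α) : Finset α :=
  (l.toFinset.erase ⊥).erase ⊤

section ELShelling

variable {α : Type*}

theorem chainWord_cons_cons (lab : α → α → ℤ) (a b : α) (l : List α) :
    chainWord lab (a :: b :: l) = lab a b :: chainWord lab (b :: l) := by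
  simp [chainWord]

theorem chainWord_append_cons (lab : α → α → ℤ) (p : List α) (a : α) (q : List α) :
    chainWord lab (p ++ a :: q) = chainWord lab (p ++ [a]) ++ chainWord lab (a :: q) := by
  induction p with
  | nil => simp [chainWord]
  | cons b p ih =>
    cases p with
    | nil => simp [chainWord]
    | cons c p =>
      simp only [List.cons_append] at ih
      simp only [List.cons_append, chainWord_cons_cons, ih]

theorem length_chainWord (lab : α → α → ℤ) (l : List α) :
    (chainWord lab l).length = l.length - 1 := by
  simp [chainWord]

theorem List.Lex.append_append_of_length_eq {β : Type*} {r : β → β → Prop} {u v : List β}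
    (h : List.Lex r u v) (hlen : u.length = v.length) (s t : List β) :
    List.Lex r (u ++ s) (v ++ t) := by
  induction h with
  | nil => simp at hlen
  | cons _ ih => exact List.Lex.cons (ih (by simpa using hlen))
  | rel h => exact List.Lex.rel h

/-- A chain whose word is not strictly increasing has a non-ascent. -/
theorem exists_nonascent (lab : α → α → ℤ) (l : List α)
    (h : ¬ (chainWord lab l).IsChain (· < ·)) :
    ∃ p a b c s, l = p ++ a :: b :: c :: s ∧ ¬ lab a b < lab b c := by
  induction l with
  | nil => simp [chainWord] at h
  | cons a l ih =>
    match l, ih, h with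
    | [], _, h => simp [chainWord] at h
    | [b], _, h => simp [chainWord] at h
    | b :: c :: s, ih, h =>
      by_cases hab : lab a b < lab b c
      · rw [chainWord_cons_cons, chainWord_cons_cons, List.isChain_cons_cons,
          ← chainWord_cons_cons] at h
        obtain ⟨p, a', b', c', s', hl, hn⟩ := ih fun h' => h ⟨hab, h'⟩
        exact ⟨a :: p, a', b', c', s', by rw [hl]; rfl, hn⟩
      · exact ⟨[], a, b, c, s, rfl, hab⟩

theorem List.exists_first_mem (l m : List α) (h : ∃ g ∈ l, g ∈ m) :
    ∃ u g v, l = u ++ g :: v ∧ g ∈ m ∧ ∀ b ∈ u, b ∉ m := by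
  induction l with
  | nil => simp at h
  | cons a l ih =>
    by_cases ha : a ∈ m
    · exact ⟨[], a, l, rfl, ha, by simp⟩
    · obtain ⟨u, g, v, hl, hg, hu⟩ := ih (by simpa [ha] using h)
      exact ⟨a :: u, g, v, by rw [hl]; rfl, hg, by simpa [ha] using hu⟩

variable [PartialOrder α]

namespace IsSatChain

theorem isChain {x y : α} {l : List α} (h : IsSatChain x y l) : l.IsChain (· ⋖ ·) := h.1

theorem exists_eq_cons {x y : α} {l : List α} (h : IsSatChain x y l) :
    ∃ l', l = x :: l' := by
  obtain ⟨-, h, -⟩ := h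
  cases l with
  | nil => simp at h
  | cons a l => exact ⟨l, by simpa using h⟩

theorem right_mem {x y : α} {l : List α} (h : IsSatChain x y l) : y ∈ l :=
  List.mem_of_getLast? h.2.2

theorem left_mem {x y : α} {l : List α} (h : IsSatChain x y l) : x ∈ l :=
  List.mem_of_head? h.2.1

theorem pairwise_lt {x y : α} {l : List α} (h : IsSatChain x y l) : l.Pairwise (· < ·) :=
  List.isChain_iff_pairwise.1 (List.IsChain.imp (fun _ _ h => h.lt) h.1)

theorem tail {x z y : α} {l : List α} (h : IsSatChain x y (x :: z :: l)) :
    IsSatChain z y (z :: l) := by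
  obtain ⟨h1, -, h3⟩ := h
  exact ⟨(List.isChain_cons_cons.1 h1).2, rfl, by simpa using h3⟩

theorem left_of_append {x y g : α} {u v : List α} (h : IsSatChain x y (x :: u ++ g :: v)) :
    IsSatChain x g (x :: u ++ [g]) := by
  obtain ⟨h1, -, -⟩ := h
  refine ⟨?_, rfl, List.getLast?_concat⟩
  have : x :: u ++ g :: v = (x :: u ++ [g]) ++ v := by simp
  rw [this] at h1
  exact List.IsChain.left_of_append h1

theorem length_add {rk : α → ℕ} (hcov : ∀ x y : α, x ⋖ y → rk y = rk x + 1)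
    {x y : α} {l : List α} (h : IsSatChain x y l) : l.length + rk x = rk y + 1 := by
  induction l generalizing x with
  | nil => simp [IsSatChain] at h
  | cons a l ih =>
    obtain ⟨l', hl⟩ := h.exists_eq_cons
    obtain ⟨rfl, rfl⟩ := List.cons.inj hl
    cases l with
    | nil =>
      have : a = y := by simpa using h.2.2
      subst this
      simp [add_comm]
    | cons b l =>
      have h1 := ih h.tail
      have h2 := hcov _ _ (List.isChain_cons_cons.1 h.1).1
      simp only [List.length_cons] at h1 ⊢
      omega

/-- Replacing one interior element of a saturated chain. -/
theorem replace {x y a b c b' : α} {p s : List α}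
    (h : IsSatChain x y (p ++ a :: b :: c :: s)) (hab : a ⋖ b') (hbc : b' ⋖ c) :
    IsSatChain x y (p ++ a :: b' :: c :: s) := by
  have h1 := h.isChain
  obtain ⟨-, h2, h3⟩ := h
  refine ⟨show List.IsChain _ _ from ?_, ?_, ?_⟩
  · rw [List.isChain_append] at h1 ⊢
    simp only [List.isChain_cons_cons] at h1 ⊢
    exact ⟨h1.1, ⟨hab, hbc, h1.2.1.2.2⟩, by simpa using h1.2.2⟩
  · cases p <;> simpa using h2
  · simpa [List.getLast?_append] using h3

theorem eq_of_mem_iff {x y x' y' : α} {l m : List α} (hl : IsSatChain x y l)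
    (hm : IsSatChain x' y' m) (h : ∀ a, a ∈ l ↔ a ∈ m) : l = m := by
  have nd : ∀ {l : List α}, l.Pairwise (· < ·) → l.Nodup := fun h => h.imp fun h => h.ne
  have hp := (List.perm_ext_iff_of_nodup (nd hl.pairwise_lt) (nd hm.pairwise_lt)).2 h
  exact hp.eq_of_pairwise (fun a b _ _ h h' => (lt_asymm h h').elim) hl.pairwise_lt hm.pairwise_lt

end IsSatChain

/-- Two distinct saturated chains of an interval: either the first one lexicographically precedes
the second one, or it has a non-ascent at an element not in the second one. -/
theorem IsELLabeling.lex_or_exists_nonascent {lab : α → α → ℤ} (hEL : IsELLabeling lab)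
    {rk : α → ℕ} (hcov : ∀ x y : α, x ⋖ y → rk y = rk x + 1) {x y : α} {l m : List α}
    (hl : IsSatChain x y l) (hm : IsSatChain x y m) (hne : l ≠ m) :
    List.Lex (· < ·) (chainWord lab l) (chainWord lab m) ∨
      ∃ p a b c s, l = p ++ a :: b :: c :: s ∧ ¬ lab a b < lab b c ∧ b ∉ m := by
  induction l generalizing x m with
  | nil => simp [IsSatChain] at hl
  | cons a l ih =>
    obtain ⟨l', hl'⟩ := hl.exists_eq_cons
    obtain ⟨rfl, rfl⟩ := List.cons.inj hl'
    obtain ⟨m, rfl⟩ := hm.exists_eq_cons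
    have hlen := hl.length_add hcov
    have hlen' := hm.length_add hcov
    match l, m with
    | [], [] => exact absurd rfl hne
    | [], _ :: _ => simp at hlen hlen'; omega
    | _ :: _, [] => simp at hlen hlen'; omega
    | z :: l, z' :: m =>
      have hpw := hl.pairwise_lt
      by_cases hz : z = z'
      · subst hz
        rcases ih hl.tail hm.tail (fun h => hne (by rw [h])) with h | ⟨p, a', b, c, s, h, hn, hb⟩
        · left
          rw [chainWord_cons_cons, chainWord_cons_cons]
          exact List.Lex.cons h
        · right
          refine ⟨a :: p, a', b, c, s, by rw [h]; rfl, hn, ?_⟩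
          have : b ∈ z :: l := by rw [h]; simp
          have hab : a < b := (List.pairwise_cons.1 hpw).1 b this
          rw [List.mem_cons, not_or]
          exact ⟨hab.ne', hb⟩
      · obtain ⟨u, g, v, hu, hg, hum⟩ := List.exists_first_mem (z :: l) (z' :: m)
          ⟨y, hl.tail.right_mem, hm.tail.right_mem⟩
        obtain ⟨u', v', hu'⟩ := List.append_of_mem hg
        rw [hu] at hl hpw
        rw [hu'] at hm
        have hl1 : IsSatChain a g (a :: u ++ [g]) := IsSatChain.left_of_append hl
        have hm1 : IsSatChain a g (a :: u' ++ [g]) := IsSatChain.left_of_append hm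
        by_cases hinc : (chainWord lab (a :: u ++ [g])).IsChain (· < ·)
        · left
          have hneq : a :: u' ++ [g] ≠ a :: u ++ [g] := by
            intro h
            have h : u' = u := by simpa using h
            subst h
            apply hz
            cases u' with
            | nil => simp at hu hu'; rw [hu.1, hu'.1]
            | cons => simp at hu hu'; rw [hu.1, hu'.1]
          have hlex := (hEL a g ((List.pairwise_cons.1 hpw).1 g (by simp)).le).2 _ _ hl1 hinc hm1 hneq
          rw [hu, hu', ← List.cons_append, ← List.cons_append, chainWord_append_cons,
            chainWord_append_cons lab (a :: u')]
          refine hlex.append_append_of_length_eq ?_ _ _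
          have h1 := hl1.length_add hcov
          have h2 := hm1.length_add hcov
          rw [length_chainWord, length_chainWord]
          omega
        · right
          obtain ⟨p, a', b, c, s, h, hn⟩ := exists_nonascent _ _ hinc
          refine ⟨p, a', b, c, s ++ v, ?_, hn, ?_⟩
          · have : a :: z :: l = (a :: u ++ [g]) ++ v := by simp [hu]
            rw [this, h]; simp
          · have hbu : b ∈ u := by
              have h' := congrArg (fun l => l.tail.dropLast) h
              have e : (p ++ a' :: b :: c :: s).tail.dropLast =
                  (p ++ [a']).tail ++ b :: (c :: s).dropLast := by
                cases p <;> simp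
              simp only [e] at h'
              have : u = (p ++ [a']).tail ++ b :: (c :: s).dropLast := by simpa using h'
              rw [this]; simp
            have hab : a < b := (List.pairwise_cons.1 hpw).1 b (by simp [hbu])
            rw [List.mem_cons, not_or]
            exact ⟨hab.ne', hum b hbu⟩

/-- A non-ascent can be exchanged for an ascent, which makes the word smaller. -/
theorem IsELLabeling.exists_replace {lab : α → α → ℤ} (hEL : IsELLabeling lab)
    {rk : α → ℕ} (hcov : ∀ x y : α, x ⋖ y → rk y = rk x + 1) {x y a b c : α} {p s : List α}
    (hl : IsSatChain x y (p ++ a :: b :: c :: s)) (hn : ¬ lab a b < lab b c) :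
    ∃ b', a ⋖ b' ∧ b' ⋖ c ∧ b' ≠ b ∧
      List.Lex (· < ·) (chainWord lab (p ++ a :: b' :: c :: s))
        (chainWord lab (p ++ a :: b :: c :: s)) := by
  have h := (List.isChain_append.1 hl.isChain).2.1
  simp only [List.isChain_cons_cons] at h
  obtain ⟨hab, hbc, -⟩ := h
  have hsat : IsSatChain a c [a, b, c] := ⟨show List.IsChain _ _ by simp [hab, hbc], rfl, rfl⟩
  obtain ⟨⟨l, ⟨hl0, hinc⟩, -⟩, hlex⟩ := hEL a c (hab.lt.trans hbc.lt).le
  have hlen := hl0.length_add hcov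
  rw [hcov _ _ hbc, hcov _ _ hab] at hlen
  obtain ⟨a', b', c', rfl⟩ := List.length_eq_three.1 (show l.length = 3 by omega)
  have h1 := hl0.isChain
  have hinc' : List.IsChain _ _ := hinc
  obtain ⟨-, h2, h3⟩ := id hl0
  obtain rfl : a' = a := by simpa using h2
  obtain rfl : c' = c := by simpa using h3
  have hcv : a' ⋖ b' ∧ b' ⋖ c' := by simpa using h1
  have hbb : b' ≠ b := by
    rintro rfl
    exact hn (by simpa [chainWord] using hinc')
  refine ⟨b', hcv.1, hcv.2, hbb, ?_⟩
  have hx := hlex _ _ hl0 hinc hsat (by simpa using hbb.symm)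
  rw [chainWord_append_cons, chainWord_append_cons lab p a' (b :: c' :: s)]
  refine List.Lex.append_left _ ?_ _
  have := hx.append_append_of_length_eq (by simp [chainWord]) (chainWord lab (c' :: s))
    (chainWord lab (c' :: s))
  simpa [chainWord] using this

theorem mem_chainFacet [BoundedOrder α] [DecidableEq α] {l : List α} {a : α} :
    a ∈ chainFacet l ↔ a ≠ ⊤ ∧ a ≠ ⊥ ∧ a ∈ l := by
  simp [chainFacet]

theorem chainFacet_injOn [BoundedOrder α] [DecidableEq α] :
    Set.InjOn (chainFacet (α := α)) {l | IsSatChain (⊥ : α) ⊤ l} := by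
  intro l hl m hm h
  refine IsSatChain.eq_of_mem_iff hl hm fun a => ?_
  have ha : a ∈ chainFacet l ↔ a ∈ chainFacet m := by rw [h]
  rw [mem_chainFacet, mem_chainFacet] at ha
  by_cases h1 : a = ⊤
  · subst h1
    exact iff_of_true hl.right_mem hm.right_mem
  by_cases h2 : a = ⊥
  · subst h2
    exact iff_of_true hl.left_mem hm.left_mem
  simpa [h1, h2] using ha

/-- The exchange property behind shellability: if `l` does not precede `m ≠ l`, some strictly
smaller maximal chain meets `l` in a codimension one face containing `m ∩ l`. -/
theorem IsELLabeling.exists_exchange [BoundedOrder α] [DecidableEq α] {lab : α → α → ℤ}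
    (hEL : IsELLabeling lab) {rk : α → ℕ} (hcov : ∀ x y : α, x ⋖ y → rk y = rk x + 1)
    {l m : List α} (hl : IsSatChain (⊥ : α) ⊤ l) (hm : IsSatChain (⊥ : α) ⊤ m) (hne : l ≠ m)
    (hle : ¬ List.Lex (· < ·) (chainWord lab l) (chainWord lab m)) :
    ∃ n, IsSatChain (⊥ : α) ⊤ n ∧ List.Lex (· < ·) (chainWord lab n) (chainWord lab l) ∧
      chainFacet m ∩ chainFacet l ⊆ chainFacet n ∩ chainFacet l ∧
      ∃ x ∈ chainFacet n, chainFacet n ∩ chainFacet l = (chainFacet n).erase x := by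
  obtain ⟨p, a, b, c, s, rfl, hn, hb⟩ :=
    (hEL.lex_or_exists_nonascent hcov hl hm hne).resolve_left hle
  obtain ⟨b', hab, hbc, hbb, hlex⟩ := hEL.exists_replace hcov hl hn
  have hpw := hl.pairwise_lt
  simp only [List.pairwise_append, List.pairwise_cons, List.mem_cons] at hpw
  obtain ⟨-, ⟨-, -, hc, -⟩, hp⟩ := hpw
  have hb' : b' ∉ p ++ a :: b :: c :: s := by
    simp only [List.mem_append, List.mem_cons]
    rintro (h | h | h | h | h)
    · exact lt_asymm hab.lt (hp _ h a (Or.inl rfl))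
    · exact hab.lt.ne' h
    · exact hbb h
    · exact hbc.lt.ne h
    · exact lt_asymm hbc.lt (hc _ h)
  refine ⟨_, hl.replace hab hbc, hlex, ?_, b', ?_, ?_⟩
  · intro z hz
    simp only [Finset.mem_inter, mem_chainFacet, List.mem_append, List.mem_cons] at hz ⊢
    have : z ≠ b := by
      rintro rfl
      exact hb hz.1.2.2
    tauto
  · exact mem_chainFacet.2 ⟨(hbc.lt.trans_le le_top).ne, (bot_le.trans_lt hab.lt).ne', by simp⟩
  · ext z
    simp only [Finset.mem_inter, Finset.mem_erase, mem_chainFacet]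
    have : z ∈ p ++ a :: b :: c :: s → z ≠ b' := by
      rintro h rfl
      exact hb' h
    simp only [List.mem_append, List.mem_cons] at this ⊢
    tauto

end ELShelling

/-- if a finite graded poset `P` of rank `d` with `0̂` and `1̂` admits an
EL-labeling, then its order complex `Δ(P)` is shellable: there is an ordering
`F_1, …, F_t` of the maximal chains of `P ∖ {0̂, 1̂}` such that for all `j < k` there is
`j' < k` with `F_j ∩ F_k ⊆ F_{j'} ∩ F_k = F_{j'} − x` for some `x ∈ F_{j'}`. -/
theorem EL_implies_shellable {α : Type*} [Fintype α] [PartialOrder α] [BoundedOrder α]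
    [DecidableEq α] (d : ℕ) (rk : α → ℕ)
    (hrk0 : rk ⊥ = 0) (hrkd : rk ⊤ = d)
    (hcov : ∀ x y : α, x ⋖ y → rk y = rk x + 1)
    (lab : α → α → ℤ) (hEL : IsELLabeling lab) :
    ∃ F : List (Finset α), F.Nodup ∧
      (∀ G : Finset α, G ∈ F ↔ ∃ l : List α, IsSatChain (⊥ : α) (⊤ : α) l ∧ G = chainFacet l) ∧
      ∀ j k : ℕ, j < k → k < F.length →
        ∃ j' : ℕ, j' < k ∧
          F.getD j ∅ ∩ F.getD k ∅ ⊆ F.getD j' ∅ ∩ F.getD k ∅ ∧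
          ∃ x ∈ F.getD j' ∅, F.getD j' ∅ ∩ F.getD k ∅ = (F.getD j' ∅).erase x := by
  classical
  let IsFacet : Finset α → Prop := fun G =>
    ∃ l : List α, IsSatChain (⊥ : α) (⊤ : α) l ∧ G = chainFacet l
  let chain : Finset α → List α := fun G => if h : IsFacet G then h.choose else []
  have chain_spec : ∀ G, IsFacet G → IsSatChain ⊥ ⊤ (chain G) ∧ G = chainFacet (chain G) := by
    intro G h
    simp only [chain, dif_pos h]
    exact h.choose_spec
  have chain_facet : ∀ l, IsSatChain (⊥ : α) ⊤ l → chain (chainFacet l) = l := by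
    intro l hl
    have h := chain_spec _ ⟨l, hl, rfl⟩
    exact chainFacet_injOn h.1 hl h.2.symm
  let r : Finset α → Finset α → Prop := fun G H =>
    chainWord lab (chain G) ≤ chainWord lab (chain H)
  have : Std.Total r := ⟨fun G H => le_total (chainWord lab (chain G)) _⟩
  have : IsTrans (Finset α) r := ⟨fun G H K h h' => le_trans (α := List ℤ) h h'⟩
  let F := (Finset.univ.filter IsFacet).toList.insertionSort r
  have hF : F.Pairwise r := List.pairwise_insertionSort r _
  have hmem : ∀ G, G ∈ F ↔ IsFacet G := fun G => by simp [F, List.mem_insertionSort]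
  have hnd : F.Nodup := (List.perm_insertionSort r _).nodup_iff.2 (Finset.nodup_toList _)
  refine ⟨F, hnd, hmem, fun j k hjk hk => ?_⟩
  have hj : j < F.length := hjk.trans hk
  have hr : r F[j] F[k] := List.pairwise_iff_getElem.1 hF j k hj hk hjk
  obtain ⟨hmj, ej⟩ := chain_spec F[j] ((hmem _).1 (List.getElem_mem hj))
  obtain ⟨hmk, ek⟩ := chain_spec F[k] ((hmem _).1 (List.getElem_mem hk))
  have hne : chain F[k] ≠ chain F[j] := by
    intro h
    rw [← h, ← ek] at ej
    exact hjk.ne (hnd.getElem_inj_iff.1 ej)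
  obtain ⟨n, hn, hlex, hsub, hx⟩ := hEL.exists_exchange hcov hmk hmj hne (not_lt_of_ge hr)
  obtain ⟨i, hi, ei⟩ := List.getElem_of_mem ((hmem _).2 ⟨n, hn, rfl⟩)
  rw [← ej, ← ek, ← ei] at hsub
  rw [← ek, ← ei] at hx
  refine ⟨i, ?_, ?_⟩
  · by_contra hik
    have hki : r F[k] F[i] := by
      rcases (not_lt.1 hik).eq_or_lt with h | h
      · subst h
        exact le_refl (α := List ℤ) _
      · exact List.pairwise_iff_getElem.1 hF k i hk hi h
    simp only [r, ei, chain_facet n hn] at hki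
    exact not_lt_of_ge hki hlex
  · simp only [List.getD_eq_getElem _ _ hi, List.getD_eq_getElem _ _ hj,
      List.getD_eq_getElem _ _ hk]
    exact ⟨hsub, hx⟩
end

section
/- Let L be a finite geometric lattice of rank d with atoms listed in a fixed linear order a_1, a_2, …, a_ℓ. Define the minimal labeling ν on covering pairs by ν(x,y) = min{ i : x ∨ a_i = y }. Then ν is an EL-labeling of L. -/
theorem IsSatChain.eq_or_exists_cons {α : Type*} [PartialOrder α] {x y : α} {l : List α}
    (h : IsSatChain x y l) :
    (x = y ∧ l = [x]) ∨ ∃ z t, l = x :: z :: t ∧ x ⋖ z ∧ IsSatChain z y (z :: t) := by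
  obtain ⟨hc, hh, hl⟩ := h
  match l, hc, hh, hl with
  | [w], _, hh, hl =>
    simp only [List.head?_cons, Option.some.injEq, List.getLast?_singleton] at hh hl
    exact Or.inl ⟨hh.symm.trans hl, by rw [hh]⟩
  | w :: z :: t, hc, hh, hl =>
    obtain rfl : w = x := by simpa using hh
    obtain ⟨hwz, hc⟩ := List.isChain_cons_cons.1 hc
    exact Or.inr ⟨z, t, rfl, hwz, hc, rfl, by simpa [List.getLast?_cons_cons] using hl⟩

theorem IsSatChain.cons {α : Type*} [PartialOrder α] {x y z : α} {t : List α}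
    (hxz : x ⋖ z) (h : IsSatChain z y (z :: t)) : IsSatChain x y (x :: z :: t) :=
  ⟨List.isChain_cons_cons.2 ⟨hxz, h.1⟩, rfl, by simpa [List.getLast?_cons_cons] using h.2.2⟩

theorem IsSatChain.le {α : Type*} [PartialOrder α] {x y : α} {l : List α}
    (h : IsSatChain x y l) : x ≤ y := by
  induction l generalizing x with
  | nil => simp [IsSatChain] at h
  | cons w l ih =>
    obtain ⟨hxy, -⟩ | ⟨z, t, hl, hxz, ht⟩ := h.eq_or_exists_cons
    · exact hxy.le
    · obtain ⟨-, rfl⟩ := List.cons.inj hl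
      exact hxz.le.trans (ih ht)

theorem chainWord_cons_cons_s8 {α : Type*} (lab : α → α → ℤ) (x z : α) (t : List α) :
    chainWord lab (x :: z :: t) = lab x z :: chainWord lab (z :: t) := rfl

/-- If a strictly increasing chain passes from outside to inside the principal filter of `b`,
and every covering pair doing so has label at most `n`, then its first label is at most `n`. -/
theorem IsSatChain.first_label_le {α : Type*} [PartialOrder α] {lab : α → α → ℤ} {b : α} {n : ℤ}
    (hb : ∀ u v : α, u ⋖ v → b ≤ v → ¬ b ≤ u → lab u v ≤ n) {x y z : α} {t : List α}
    (h : IsSatChain z y (z :: t)) (hxz : x ⋖ z)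
    (hinc : (chainWord lab (x :: z :: t)).IsChain (· < ·)) (hby : b ≤ y) (hbx : ¬ b ≤ x) :
    lab x z ≤ n := by
  induction t generalizing x z with
  | nil =>
    obtain ⟨rfl, -⟩ | ⟨w, t, hl, -⟩ := h.eq_or_exists_cons
    · exact hb x z hxz hby hbx
    · simp at hl
  | cons v t ih =>
    by_cases hbz : b ≤ z
    · exact hb x z hxz hbz hbx
    · obtain ⟨-, hl⟩ | ⟨w, t, hl, hzw, ht⟩ := h.eq_or_exists_cons
      · simp at hl
      · obtain ⟨rfl, rfl⟩ := List.cons.inj (List.cons.inj hl).2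
        rw [chainWord_cons_cons_s8, chainWord_cons_cons_s8, List.isChain_cons_cons] at hinc
        exact hinc.1.le.trans (ih ht hzw hinc.2 hbz)

/-- A strictly increasing saturated chain lexicographically precedes every other saturated chain
of its interval, provided that its first label is smaller than that of any other cover. -/
theorem IsSatChain.lex_of_increasing {α : Type*} [PartialOrder α] {lab : α → α → ℤ}
    (hfirst : ∀ {x y z w : α} {t : List α}, x ⋖ z → IsSatChain z y (z :: t) →
      (chainWord lab (x :: z :: t)).IsChain (· < ·) → x ⋖ w → w ≤ y → z ≠ w → lab x z < lab x w)
    {x y : α} {l l' : List α} (h : IsSatChain x y l)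
    (hinc : (chainWord lab l).IsChain (· < ·)) (h' : IsSatChain x y l') (hne : l' ≠ l) :
    List.Lex (· < ·) (chainWord lab l) (chainWord lab l') := by
  induction l generalizing x l' with
  | nil => simp [IsSatChain] at h
  | cons u l ih =>
    obtain ⟨hxy, hl⟩ | ⟨z, t, hl, hxz, ht⟩ := h.eq_or_exists_cons <;>
    obtain ⟨hxy', hl'⟩ | ⟨w, t', hl', hxw, ht'⟩ := h'.eq_or_exists_cons
    · exact absurd (hl'.trans hl.symm) hne
    · exact absurd (hxw.lt.trans_le ht'.le) (hxy ▸ lt_irrefl _)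
    · exact absurd (hxz.lt.trans_le ht.le) (hxy' ▸ lt_irrefl _)
    · obtain ⟨rfl, rfl⟩ := List.cons.inj hl
      subst hl'
      rw [chainWord_cons_cons_s8, chainWord_cons_cons_s8]
      obtain rfl | hzw := eq_or_ne z w
      · rw [chainWord_cons_cons_s8] at hinc
        exact List.Lex.cons (ih ht hinc.tail ht' fun h => hne (by rw [h]))
      · exact List.Lex.rel (hfirst hxz ht hinc hxw ht'.le hzw)

/-- Strictly increasing saturated chains exist as soon as every `x < y` has a cover `z ≤ y` whose
label is smaller than the labels of the covers of `z` in `[z, y]`. -/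
theorem exists_increasing_isSatChain {α : Type*} [PartialOrder α] [WellFoundedGT α]
    {lab : α → α → ℤ}
    (hstep : ∀ x y : α, x < y → ∃ z, x ⋖ z ∧ z ≤ y ∧ ∀ w, z ⋖ w → w ≤ y → lab x z < lab z w)
    {x y : α} (hxy : x ≤ y) :
    ∃ l, IsSatChain x y l ∧ (chainWord lab l).IsChain (· < ·) := by
  induction x using WellFoundedGT.induction with
  | ind x ih =>
    obtain rfl | hlt := hxy.eq_or_lt
    · exact ⟨[x], ⟨List.isChain_singleton _, rfl, rfl⟩, List.isChain_nil⟩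
    obtain ⟨z, hxz, hzy, hz⟩ := hstep x y hlt
    obtain ⟨l, hl, hinc⟩ := ih z hxz.lt hzy
    obtain ⟨-, rfl⟩ | ⟨w, t, rfl, hzw, ht⟩ := hl.eq_or_exists_cons
    · exact ⟨[x, z], hl.cons hxz, List.isChain_singleton _⟩
    · refine ⟨x :: z :: w :: t, hl.cons hxz, ?_⟩
      rw [chainWord_cons_cons_s8] at hinc
      rw [chainWord_cons_cons_s8, chainWord_cons_cons_s8, List.isChain_cons_cons]
      exact ⟨hz w hzw ht.le, hinc⟩

theorem IsELLabeling.of_covers {α : Type*} [PartialOrder α] [WellFoundedGT α]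
    {lab : α → α → ℤ}
    (hfirst : ∀ {x y z w : α} {t : List α}, x ⋖ z → IsSatChain z y (z :: t) →
      (chainWord lab (x :: z :: t)).IsChain (· < ·) → x ⋖ w → w ≤ y → z ≠ w → lab x z < lab x w)
    (hstep : ∀ x y : α, x < y → ∃ z, x ⋖ z ∧ z ≤ y ∧ ∀ w, z ⋖ w → w ≤ y → lab x z < lab z w) :
    IsELLabeling lab := by
  intro x y hxy
  have hlex : ∀ l l' : List α, IsSatChain x y l → (chainWord lab l).IsChain (· < ·) →
      IsSatChain x y l' → l' ≠ l → List.Lex (· < ·) (chainWord lab l) (chainWord lab l') :=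
    fun l l' h hinc h' hne => h.lex_of_increasing hfirst hinc h' hne
  refine ⟨?_, hlex⟩
  obtain ⟨l, hl, hinc⟩ := exists_increasing_isSatChain hstep hxy
  refine ⟨l, ⟨hl, hinc⟩, fun l' ⟨hl', hinc'⟩ => ?_⟩
  by_contra hne
  exact asymm_of (List.Lex (· < ·)) (hlex l l' hl hinc hl' hne) (hlex l' l hl' hinc' hl (Ne.symm hne))

/-- let `L` be a finite geometric lattice (atomistic and semimodular) of
rank `d`, with its atoms listed in a fixed linear order `a_1, …, a_ℓ` (here
`a : Fin ℓ → L`, a bijection onto the set of atoms).  The minimal labeling, defined on a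
covering pair `x ⋖ y` as the least index `i` with `x ∨ a_i = y`, is an EL-labeling. -/
theorem minimal_labeling_is_EL {α : Type*} [Fintype α] [Lattice α] [BoundedOrder α]
    (d : ℕ) (rk : α → ℕ)
    (hrk0 : rk ⊥ = 0) (hrkd : rk ⊤ = d)
    (hcov : ∀ x y : α, x ⋖ y → rk y = rk x + 1)
    (hatomistic : ∀ x : α, ∃ s : Finset α, (∀ b ∈ s, IsAtom b) ∧ x = s.sup id)
    (hsemimodular : ∀ x y : α, x ⊓ y ⋖ y → x ⋖ x ⊔ y)
    (ℓ : ℕ) (a : Fin ℓ → α)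
    (hainj : Function.Injective a) (ha : ∀ b : α, IsAtom b ↔ ∃ i : Fin ℓ, a i = b)
    (ν : α → α → ℤ)
    (hν : ∀ x y : α, x ⋖ y → ∃ i : Fin ℓ, x ⊔ a i = y ∧
      (∀ j : Fin ℓ, x ⊔ a j = y → i ≤ j) ∧ ν x y = (i : ℕ) + 1) :
    IsELLabeling ν := by
  have hatom : ∀ i, IsAtom (a i) := fun i => (ha _).2 ⟨i, rfl⟩
  have hcover : ∀ (x : α) (i : Fin ℓ), ¬ a i ≤ x → x ⋖ x ⊔ a i := by
    intro x i hi
    apply hsemimodular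
    have hbot : x ⊓ a i = ⊥ :=
      ((hatom i).le_iff.1 inf_le_right).resolve_right fun h => hi (inf_eq_right.1 h)
    rw [hbot]
    exact bot_covBy_iff.2 (hatom i)
  have hsup : ∀ (x y : α) (i : Fin ℓ), x ⋖ y → a i ≤ y → ¬ a i ≤ x → x ⊔ a i = y :=
    fun x y i hxy hiy hix =>
      (hxy.eq_or_eq le_sup_left (sup_le hxy.le hiy)).resolve_left fun h => hix (sup_eq_left.1 h)
  have hle : ∀ (i : Fin ℓ) (u v : α), u ⋖ v → a i ≤ v → ¬ a i ≤ u → ν u v ≤ (i : ℕ) + 1 := by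
    intro i u v huv hiv hiu
    obtain ⟨k, -, hmin, hk⟩ := hν u v huv
    have : (k : ℕ) ≤ i := hmin i (hsup u v i huv hiv hiu)
    omega
  have hex : ∀ x y : α, x ⋖ y → ∃ i : Fin ℓ, x ⊔ a i = y ∧ a i ≤ y ∧ ¬ a i ≤ x ∧
      ν x y = (i : ℕ) + 1 := by
    intro x y hxy
    obtain ⟨i, hi, -, hv⟩ := hν x y hxy
    exact ⟨i, hi, hi ▸ le_sup_right, fun h => hxy.ne ((sup_eq_left.2 h).symm.trans hi), hv⟩
  apply IsELLabeling.of_covers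
  · intro x y z w t hxz ht hinc hxw hwy hzw
    obtain ⟨i, hi, hiw, hix, hv⟩ := hex x w hxw
    obtain ⟨k, hk, -, -, hv'⟩ := hex x z hxz
    have hlei := ht.first_label_le (hle i) hxz hinc (hiw.trans hwy) hix
    refine lt_of_le_of_ne (hlei.trans hv.ge) fun heq => hzw ?_
    obtain rfl : k = i := Fin.ext (by omega)
    exact hk.symm.trans hi
  · intro x y hxy
    have hne : ∃ i : Fin ℓ, a i ≤ y ∧ ¬ a i ≤ x := by
      by_contra! hall
      obtain ⟨s, hs, rfl⟩ := hatomistic y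
      refine hxy.not_ge (Finset.sup_le fun b hb => ?_)
      obtain ⟨i, rfl⟩ := (ha b).1 (hs b hb)
      exact hall i (Finset.le_sup (f := id) hb)
    obtain ⟨i, ⟨hiy, hix⟩, hmin⟩ := WellFounded.has_min (wellFounded_lt (α := Fin ℓ))
      {i | a i ≤ y ∧ ¬ a i ≤ x} hne
    refine ⟨x ⊔ a i, hcover x i hix, sup_le hxy.le hiy, fun w hzw hwy => ?_⟩
    obtain ⟨k, -, hkw, hkz, hv⟩ := hex _ w hzw
    have hik : i ≤ k := not_lt.1 (hmin k ⟨hkw.trans hwy, fun h => hkz (h.trans le_sup_left)⟩)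
    have hik_ne : i ≠ k := by
      rintro rfl
      exact hkz le_sup_right
    have hlt : (i : ℕ) < k := Fin.lt_def.1 (lt_of_le_of_ne hik hik_ne)
    have := hle i x _ (hcover x i hix) le_sup_right hix
    omega
end

section
/- Fix an S_d-EL-labeling λ of the Boolean lattice B_d and S ⊆ [d−1], and let d_1, …, d_t, L_i, Γ_i be as in the associated construction. If e is a maximal chain of L_i, then e is a facet of Γ_i if and only if (Υ_λ(e))_{[d−1]∖S} = (d_i)_{[d−1]∖S}. -/
/-- The descent set of a word `w_1 ⋯ w_n` : the set of `i ∈ {1,…,n−1}` with `w_i > w_{i+1}`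
(positions are `1`-based). -/
def wordDescents {β : Type*} [LinearOrder β] [Inhabited β] (w : List β) : Finset ℕ :=
  (Finset.Icc 1 (w.length - 1)).filter fun i => w.getD i default < w.getD (i - 1) default

/-- The rank-selected subchain `c_R` of a chain `c` in `B_d`: the elements of `c` whose
rank (cardinality) lies in `R ∪ {0, d}`. -/
def rsel (d : ℕ) (R : Finset ℕ) (l : List (Finset (Fin d))) : List (Finset (Fin d)) :=
  l.filter fun x => decide (x.card ∈ R ∪ ({0, d} : Finset ℕ))

/-- The set of maximal chains of the subposet `L_i` of `(B_d)_S`: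
`{c_S : c a maximal chain of B_d with c_{[d−1]∖S} = (d_i)_{[d−1]∖S}}`, where `d_i` is the
`i`-th entry of the list `D = [d_1, …, d_t]`. -/
def Mchain (d : ℕ) (S : Finset ℕ) (D : List (List (Finset (Fin d)))) (i : ℕ) :
    Set (List (Finset (Fin d))) :=
  {m | ∃ c : List (Finset (Fin d)), IsSatChain (⊥ : Finset (Fin d)) (⊤ : Finset (Fin d)) c ∧
    rsel d (Finset.Icc 1 (d - 1) \ S) c = rsel d (Finset.Icc 1 (d - 1) \ S) (D.getD i []) ∧
    m = rsel d S c}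

/-- The facets of `Γ_i`: the maximal chains of `L_i` that are not chains of `L_j` for any
`j < i` (a chain of `L_j` is a chain all of whose elements belong to `L_j`, i.e. lie on
some maximal chain of `L_j`). -/
def GammaFacet (d : ℕ) (S : Finset ℕ) (D : List (List (Finset (Fin d)))) (i : ℕ) :
    Set (List (Finset (Fin d))) :=
  {e | e ∈ Mchain d S D i ∧
    ¬ ∃ j < i, ∀ x ∈ e, ∃ m ∈ Mchain d S D j, x ∈ m}

/-- `l = Υ_λ(e)`: `l` is the maximal chain obtained from the chain `e` (which contains
`0̂` and `1̂`) by filling in each gap of `e` with the unique saturated chain of increasing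
`λ`-label of the corresponding interval.  Equivalently (given that `λ` is an
EL-labeling): `l` is a maximal chain containing `e` whose label word has descents only at
positions crossing elements of `e`. -/
def IsUpsilon (d : ℕ) (lab : Finset (Fin d) → Finset (Fin d) → ℤ)
    (e l : List (Finset (Fin d))) : Prop :=
  IsSatChain (⊥ : Finset (Fin d)) (⊤ : Finset (Fin d)) l ∧ e.Sublist l ∧
  ∀ k : ℕ, k + 1 < (chainWord lab l).length →
    (chainWord lab l).getD (k + 1) 0 < (chainWord lab l).getD k 0 →
    l.getD (k + 1) ⊥ ∈ e

/-- `F 0 ⊂ F 1 ⊂ ⋯ ⊂ F d` is a complete flag of subsets of `Fin d`. -/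
structure IsFlag (d : ℕ) (F : ℕ → Finset (Fin d)) : Prop where
  card_eq : ∀ k ≤ d, (F k).card = k
  subset_succ : ∀ k < d, F k ⊆ F (k + 1)

/-- The letter at position `k` of the label word of a flag. -/
def flagLabel {d : ℕ} (lab : Finset (Fin d) → Finset (Fin d) → ℤ) (F : ℕ → Finset (Fin d))
    (k : ℕ) : ℤ :=
  lab (F k) (F (k + 1))

section Words

lemma chainWord_append {α : Type*} (lab : α → α → ℤ) (p : List α) (x : α) (q : List α) :
    chainWord lab (p ++ x :: q) = chainWord lab (p ++ [x]) ++ chainWord lab (x :: q) := by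
  induction p with
  | nil => simp [chainWord]
  | cons a p ih =>
    cases p with
    | nil => simp [chainWord]
    | cons b p => simpa [chainWord] using ih

lemma List.Lex.exists_getD_lt {l l' : List ℤ} (h : List.Lex (· < ·) l l')
    (hlen : l.length = l'.length) :
    ∃ m < l.length, (∀ k < m, l.getD k 0 = l'.getD k 0) ∧ l.getD m 0 < l'.getD m 0 := by
  induction h with
  | nil => simp at hlen
  | rel h => exact ⟨0, by simp, by simp, by simpa using h⟩
  | cons _ ih =>
    obtain ⟨m, hm, heq, hlt⟩ := ih (by simpa using hlen)
    refine ⟨m + 1, by simpa using hm, ?_, by simpa using hlt⟩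
    rintro (_ | k) hk
    · simp
    · simpa using heq k (by omega)

lemma lt_of_forall_lt_succ {f : ℕ → ℤ} {a b : ℕ}
    (h : ∀ k, a ≤ k → k + 1 < b → f k < f (k + 1)) {q : ℕ} (haq : a < q) (hqb : q < b) :
    f a < f q := by
  induction q, haq using Nat.le_induction with
  | base => exact h a le_rfl hqb
  | succ q hq ih => exact (ih (by omega)).trans (h q (by omega) hqb)

lemma le_of_forall_succ_lt {f : ℕ → ℤ} {a b : ℕ}
    (h : ∀ k, a ≤ k → k + 1 < b → f (k + 1) < f k) {q : ℕ} (haq : a ≤ q) (hqb : q < b) :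
    f q ≤ f a := by
  induction q, haq using Nat.le_induction with
  | base => exact le_rfl
  | succ q hq ih => exact (h q (by omega) hqb).le.trans (ih (by omega))

lemma image_range_congr {f g : ℕ → ℤ} {k : ℕ} (h : ∀ j < k, f j = g j) :
    (Finset.range k).image f = (Finset.range k).image g :=
  Finset.image_congr fun j hj => h j (by simpa using hj)

lemma notMem_image_range {f : ℕ → ℤ} {d k n : ℕ} (hf : Set.InjOn f (Set.Iio d)) (hk : k < d)
    (hn : n ≤ k) : f k ∉ (Finset.range n).image f := by
  intro h
  obtain ⟨j, hj, hjk⟩ := Finset.mem_image.1 h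
  have hj : j < n := by simpa using hj
  have := hf (show j < d by omega) (show k < d from hk) hjk
  omega

lemma exists_eq_of_mem_image_range {f : ℕ → ℤ} {a n m : ℕ} {v : ℤ}
    (hv : v ∈ (Finset.range n).image f) (hv' : v ∉ (Finset.range m).image f) (ha : a ≤ m) :
    ∃ q, a ≤ q ∧ q < n ∧ f q = v := by
  obtain ⟨q, hq, rfl⟩ := Finset.mem_image.1 hv
  refine ⟨q, ?_, by simpa using hq, rfl⟩
  by_contra hlt
  exact hv' (Finset.mem_image_of_mem _ (by simp; omega))

variable {d : ℕ} {S : Finset ℕ} {u c f g : ℕ → ℤ}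

/-- If `u` has no descents off `S` and has the same prefix sets as `c` at the positions in
`S ∪ {d}`, then `u` precedes `c` at the first difference, which lies off `S`. -/
lemma lt_at_first_difference (hc : Set.InjOn c (Set.Iio d))
    (huc : ∀ k ≤ d, k ∈ S ∨ k = d → (Finset.range k).image u = (Finset.range k).image c)
    (hasc : ∀ k, k + 1 < d → k + 1 ∉ S → u k < u (k + 1))
    {p : ℕ} (hp : p < d) (heq : ∀ k < p, u k = c k) (hne : u p ≠ c p) :
    p + 1 ∉ S ∧ u p < c p := by
  have hcp : c p ∉ (Finset.range p).image u := by
    rw [image_range_congr heq]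
    exact notMem_image_range hc hp le_rfl
  have hex : ∃ r, p < r ∧ (r ∈ S ∨ r = d) := ⟨d, hp, Or.inr rfl⟩
  classical
  obtain ⟨y, ⟨hpy, hy⟩, hmin⟩ : ∃ y, (p < y ∧ (y ∈ S ∨ y = d)) ∧
      ∀ r < y, ¬ (p < r ∧ (r ∈ S ∨ r = d)) :=
    ⟨Nat.find hex, Nat.find_spec hex, fun r hr => Nat.find_min hex hr⟩
  have hyd : y ≤ d := by
    by_contra h
    exact hmin d (by omega) ⟨hp, Or.inr rfl⟩
  have hmem : c p ∈ (Finset.range y).image u := by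
    rw [huc y hyd hy]
    exact Finset.mem_image_of_mem _ (by simpa using hpy)
  obtain ⟨q, hpq, hqy, hq⟩ := exists_eq_of_mem_image_range hmem hcp le_rfl
  have hqp : p < q := lt_of_le_of_ne hpq (by rintro rfl; exact hne hq)
  refine ⟨fun h => hmin (p + 1) (by omega) ⟨by omega, Or.inl h⟩, ?_⟩
  rw [← hq]
  refine lt_of_forall_lt_succ (b := y) (fun k hk hky => hasc k (by omega) fun h => ?_) hqp hqy
  exact hmin (k + 1) hky ⟨by omega, Or.inl h⟩

/-- Rearranging decreasingly the blocks between positions off `S` preserves the comparison of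
`u` with `c`: the resulting words `f` and `g` cannot satisfy `g < f`. -/
lemma not_lex_lt_of_blocks
    (hc : Set.InjOn c (Set.Iio d))
    (hf : Set.InjOn f (Set.Iio d)) (hd : d ∉ S)
    (huc : ∀ k ≤ d, k ∈ S ∨ k = d → (Finset.range k).image u = (Finset.range k).image c)
    (huf : ∀ k ≤ d, k ∉ S → (Finset.range k).image u = (Finset.range k).image f)
    (hcg : ∀ k ≤ d, k ∉ S → (Finset.range k).image c = (Finset.range k).image g)
    (hasc : ∀ k, k + 1 < d → k + 1 ∉ S → u k < u (k + 1))
    (hdesc : ∀ k, k + 1 < d → k + 1 ∈ S → g (k + 1) < g k)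
    {m : ℕ} (hm : m < d) (heq : ∀ k < m, g k = f k) : ¬ g m < f m := by
  intro hlt
  have hPm := image_range_congr heq
  classical
  have hex : ∃ r, m < r ∧ r ∉ S := ⟨d, hm, hd⟩
  obtain ⟨r, ⟨hmr, hrS⟩, hmin⟩ : ∃ y, (m < y ∧ y ∉ S) ∧ ∀ r < y, ¬ (m < r ∧ r ∉ S) :=
    ⟨Nat.find hex, Nat.find_spec hex, fun r hr => Nat.find_min hex hr⟩
  have hrd : r ≤ d := by
    by_contra h
    exact hmin d (by omega) ⟨hm, hd⟩
  suffices h : ∃ w ∈ (Finset.range r).image c, w ∉ (Finset.range m).image f ∧ f m ≤ w by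
    obtain ⟨w, hw, hwm, hfw⟩ := h
    rw [hcg r hrd hrS] at hw
    rw [← hPm] at hwm
    obtain ⟨q, hmq, hqr, rfl⟩ := exists_eq_of_mem_image_range hw hwm le_rfl
    have : g q ≤ g m := le_of_forall_succ_lt (b := r)
      (fun k hk hkr => hdesc k (by omega) (by
        by_contra h
        exact hmin (k + 1) hkr ⟨by omega, h⟩)) hmq hqr
    omega
  have hfm : f m ∈ (Finset.range r).image u := by
    rw [huf r hrd hrS]
    exact Finset.mem_image_of_mem _ (by simpa using hmr)
  have hfm' := notMem_image_range hf hm le_rfl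
  by_cases hall : ∀ k < r, u k = c k
  · exact ⟨f m, image_range_congr hall ▸ hfm, hfm', le_rfl⟩
  push Not at hall
  obtain ⟨p, ⟨hpr, hpne⟩, hpmin⟩ : ∃ p, (p < r ∧ u p ≠ c p) ∧ ∀ k < p, ¬ (k < r ∧ u k ≠ c k) :=
    ⟨Nat.find hall, Nat.find_spec hall, fun r hr => Nat.find_min hall hr⟩
  have hpeq : ∀ k < p, u k = c k := fun k hk => by
    by_contra h
    exact hpmin k hk ⟨by omega, h⟩
  have hpd : p < d := by omega
  obtain ⟨hpS, hplt⟩ := lt_at_first_difference hc huc hasc hpd hpeq hpne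
  have hcp : c p ∉ (Finset.range (p + 1)).image u := by
    rw [Finset.range_add_one, Finset.image_insert, image_range_congr hpeq, Finset.mem_insert]
    rintro (h | h)
    · exact hpne h.symm
    · exact notMem_image_range hc hpd le_rfl h
  have hmp : m ≤ p := by
    by_contra h
    refine hcp ?_
    rw [huf _ (by omega) hpS, ← image_range_congr fun k hk => heq k (by omega),
      ← hcg _ (by omega) hpS]
    exact Finset.mem_image_of_mem _ (by simp)
  have hrp : r = p + 1 := by
    by_contra h
    exact hmin (p + 1) (by omega) ⟨by omega, hpS⟩
  subst hrp
  obtain ⟨q, hq, hqm⟩ := Finset.mem_image.1 hfm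
  have hq : q < p + 1 := by simpa using hq
  rcases Nat.lt_succ_iff_lt_or_eq.1 hq with hq | rfl
  · refine ⟨f m, ?_, hfm', le_rfl⟩
    rw [← hqm, hpeq q hq]
    exact Finset.mem_image_of_mem _ (by simp; omega)
  · refine ⟨c q, Finset.mem_image_of_mem _ (by simp), fun h => hcp ?_, by omega⟩
    rw [huf _ hrd hrS]
    exact Finset.image_subset_image (by simpa using by omega) h

/-- If `u` ascends off `S` and `f` is obtained from `u` by rearranging decreasingly the blocks
between positions off `S`, then `f` also ascends off `S`. -/
lemma ascent_of_blocks
    (hu : Set.InjOn u (Set.Iio d)) (h0 : 0 ∉ S) (hd : d ∉ S)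
    (huf : ∀ k ≤ d, k ∉ S → (Finset.range k).image u = (Finset.range k).image f)
    (hasc : ∀ k, k + 1 < d → k + 1 ∉ S → u k < u (k + 1))
    (hdesc : ∀ k, k + 1 < d → k + 1 ∈ S → f (k + 1) < f k)
    {k : ℕ} (hk : k + 1 < d) (hkS : k + 1 ∉ S) : f k < f (k + 1) := by
  classical
  have hleft : f k ≤ u k := by
    obtain ⟨a, ⟨hak, haS⟩, hmax⟩ : ∃ a, (a ≤ k ∧ a ∉ S) ∧ ∀ b, a < b → b ≤ k → b ∈ S := by
      refine ⟨Nat.findGreatest (· ∉ S) k, ⟨Nat.findGreatest_le k, ?_⟩, fun b hb hbk => ?_⟩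
      · exact Nat.findGreatest_spec (P := (· ∉ S)) (Nat.zero_le k) h0
      · by_contra h
        exact Nat.findGreatest_is_greatest hb hbk h
    have h1 : u k ∈ (Finset.range (k + 1)).image f := by
      rw [← huf _ hk.le hkS]
      exact Finset.mem_image_of_mem _ (by simp)
    have h2 : u k ∉ (Finset.range a).image f := by
      rw [← huf _ (by omega) haS]
      exact notMem_image_range hu (by omega) hak
    obtain ⟨q, haq, hqk, hq⟩ := exists_eq_of_mem_image_range h1 h2 le_rfl
    rw [← hq]
    exact le_of_forall_succ_lt (b := k + 1)
      (fun j hj hjk => hdesc j (by omega) (hmax _ (by omega) (by omega)))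
      (by omega) (by omega)
  have hright : u (k + 1) ≤ f (k + 1) := by
    have hex : ∃ r, k + 1 < r ∧ r ∉ S := ⟨d, hk, hd⟩
    obtain ⟨r, ⟨hkr, hrS⟩, hmin⟩ : ∃ y, (k + 1 < y ∧ y ∉ S) ∧ ∀ r < y, ¬ (k + 1 < r ∧ r ∉ S) :=
      ⟨Nat.find hex, Nat.find_spec hex, fun r hr => Nat.find_min hex hr⟩
    have hrd : r ≤ d := by
      by_contra h
      exact hmin d (by omega) ⟨hk, hd⟩
    have h1 : u (k + 1) ∈ (Finset.range r).image f := by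
      rw [← huf _ hrd hrS]
      exact Finset.mem_image_of_mem _ (by simpa using hkr)
    have h2 : u (k + 1) ∉ (Finset.range (k + 1)).image f := by
      rw [← huf _ hk.le hkS]
      exact notMem_image_range hu hk le_rfl
    obtain ⟨q, hkq, hqr, hq⟩ := exists_eq_of_mem_image_range h1 h2 le_rfl
    rw [← hq]
    exact le_of_forall_succ_lt (b := r)
      (fun j hj hjr => hdesc j (by omega) (by
        by_contra h
        exact hmin (j + 1) hjr ⟨by omega, h⟩)) hkq hqr
  exact (hleft.trans_lt (hasc k hk hkS)).trans_le hright

end Words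

lemma isSatChain_iff {α : Type*} [PartialOrder α] {x y : α} {l : List α} :
    IsSatChain x y l ↔ l.IsChain (· ⋖ ·) ∧ l.head? = some x ∧ l.getLast? = some y :=
  Iff.rfl

section Labels

variable {d : ℕ} {lab : Finset (Fin d) → Finset (Fin d) → ℤ}

lemma isSatChain_triple {x : Finset (Fin d)} {a b : Fin d} (hab : a ≠ b) (ha : a ∉ x)
    (hb : b ∉ x) :
    IsSatChain x (insert a (insert b x)) [x, insert a x, insert a (insert b x)] := by
  refine isSatChain_iff.2 ⟨?_, by simp, by simp⟩
  have h1 : x ⋖ insert a x := Finset.covBy_insert ha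
  have h2 : insert a x ⋖ insert b (insert a x) := Finset.covBy_insert (by simp [hab.symm, hb])
  rw [Finset.insert_comm] at h2
  simp [List.isChain_cons_cons, h1, h2]

lemma IsSatChain.eq_triple {x : Finset (Fin d)} {a b : Fin d} (hab : a ≠ b) (ha : a ∉ x)
    (hb : b ∉ x) {l : List (Finset (Fin d))} (hl : IsSatChain x (insert a (insert b x)) l) :
    l = [x, insert a x, insert a (insert b x)] ∨ l = [x, insert b x, insert a (insert b x)] := by
  obtain ⟨hch, hhd, hlast⟩ := isSatChain_iff.1 hl
  have hcard : (insert a (insert b x)).card = x.card + 2 := by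
    rw [Finset.card_insert_of_notMem (by simp [hab, ha]), Finset.card_insert_of_notMem hb]
  have hcov : ∀ {s t : Finset (Fin d)}, s ⋖ t → t.card = s.card + 1 := fun h => by
    obtain ⟨c, hc, rfl⟩ := Finset.covBy_iff_exists_insert.1 h
    exact Finset.card_insert_of_notMem hc
  match l, hch, hhd, hlast with
  | [y], _, hhd, hlast =>
    simp at hhd hlast
    subst hhd
    rw [← hlast] at hcard
    omega
  | [y, z], hch, hhd, hlast =>
    simp [List.isChain_cons_cons] at hch hhd hlast
    subst hhd
    have := hcov hch
    rw [hlast] at this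
    omega
  | [y, z, w], hch, hhd, hlast =>
    simp [List.isChain_cons_cons] at hch hhd hlast
    subst hhd hlast
    obtain ⟨c, hc, rfl⟩ := Finset.covBy_iff_exists_insert.1 hch.1
    have hmem : c ∈ insert a (insert b y) := hch.2.le (Finset.mem_insert_self _ _)
    simp [hc] at hmem
    rcases hmem with rfl | rfl <;> simp
  | y :: z :: w :: v :: t, hch, hhd, hlast =>
    simp only [List.isChain_cons_cons, List.head?_cons, Option.some.injEq] at hch hhd
    subst hhd
    have h1 := hcov hch.1
    have h2 := hcov hch.2.1
    have h3 := hcov hch.2.2.1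
    have hsub : v ⊆ insert a (insert b y) := by
      have hp : (v :: t).Pairwise (· ≤ ·) :=
        (hch.2.2.2.imp fun _ _ h => h.le).pairwise
      have hmem : insert a (insert b y) ∈ v :: t := by
        have hl : (v :: t).getLast? = some (insert a (insert b y)) := by simpa using hlast
        exact List.mem_of_getLast? hl
      rcases List.mem_cons.1 hmem with h | h
      · exact h.ge
      · exact (List.pairwise_cons.1 hp).1 _ h
    have := Finset.card_le_card hsub
    omega

/-- The two maximal chains of an interval of rank two carry the same pair of distinct labels in
opposite orders. -/
lemma IsSdELLabeling.diamond (hEL : IsSdELLabeling d lab) {x : Finset (Fin d)} {a b : Fin d}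
    (hab : a ≠ b) (ha : a ∉ x) (hb : b ∉ x) :
    lab x (insert a x) = lab (insert b x) (insert a (insert b x)) ∧
      lab x (insert a x) ≠ lab x (insert b x) := by
  set y := insert a (insert b x) with hy
  have hA := isSatChain_triple hab ha hb
  have hB := isSatChain_triple hab.symm hb ha
  rw [Finset.insert_comm b a x] at hB
  rw [← hy] at hA hB
  obtain ⟨p, ⟨hp, -⟩, -⟩ := (hEL.1 ⊥ x bot_le).1
  obtain ⟨q, ⟨hq, -⟩, -⟩ := (hEL.1 y ⊤ le_top).1
  obtain ⟨hp1, hp2, hp3⟩ := hp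
  obtain ⟨hq1, hq2, hq3⟩ := hq
  obtain ⟨p', rfl⟩ := List.getLast?_eq_some_iff.1 hp3
  obtain ⟨q', rfl⟩ := List.head?_eq_some_iff.1 hq2
  have hfull : ∀ z, IsSatChain x y [x, z, y] →
      IsSatChain (⊥ : Finset (Fin d)) ⊤ (p' ++ x :: z :: y :: q') := by
    intro z hz
    have hz1 := (isSatChain_iff.1 hz).1
    simp only [List.isChain_cons_cons] at hz1
    refine isSatChain_iff.2 ⟨?_, ?_, ?_⟩
    · rw [List.isChain_split]
      exact ⟨hp1, by simpa [List.isChain_cons_cons] using ⟨hz1.1, hz1.2.1, hq1⟩⟩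
    · cases p' <;> simpa using hp2
    · simpa [List.getLast?_append, List.getLast?_cons_cons] using hq3
  have hword : ∀ z, chainWord lab (p' ++ x :: z :: y :: q') =
      chainWord lab (p' ++ [x]) ++ ([lab x z, lab z y] ++ chainWord lab (y :: q')) := by
    intro z
    rw [chainWord_append]
    rfl
  have hpA := hEL.2 _ (hfull _ hA)
  have hpB := hEL.2 _ (hfull _ hB)
  rw [hword] at hpA hpB
  have hndA := hpA.nodup_iff.2 (by
    simpa [Function.comp_def, ← List.map_eq_flatMap] using
      List.nodup_range.map (f := fun i : ℕ => (i : ℤ) + 1) fun i j h => by simpa using h)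
  have hst : lab x (insert a x) ≠ lab (insert a x) y := by
    have := hndA.of_append_right.of_append_left
    simpa using this
  have hperm : [lab x (insert a x), lab (insert a x) y].Perm
      [lab x (insert b x), lab (insert b x) y] := by
    have := hpA.trans hpB.symm
    rwa [List.perm_append_left_iff, List.perm_append_right_iff] at this
  obtain ⟨⟨l, ⟨hl, hlinc⟩, huniq⟩, -⟩ := hEL.1 x y (by
    intro t ht; simp [hy, ht])
  have hne : ([x, insert a x, y] : List (Finset (Fin d))) ≠ [x, insert b x, y] := by
    intro h
    have h : insert a x = insert b x := by simpa using h
    have : a ∈ insert b x := h ▸ Finset.mem_insert_self a x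
    simp [hab, ha] at this
  have hinc : ∀ z, (chainWord lab [x, z, y]).IsChain (· < ·) ↔ lab x z < lab z y := by
    intro z
    simp [chainWord]
  have hcases : (lab x (insert a x) < lab (insert a x) y ∧
        ¬ lab x (insert b x) < lab (insert b x) y) ∨
      (¬ lab x (insert a x) < lab (insert a x) y ∧ lab x (insert b x) < lab (insert b x) y) := by
    have hnot : ¬ (lab x (insert a x) < lab (insert a x) y ∧
        lab x (insert b x) < lab (insert b x) y) := fun h =>
      hne ((huniq _ ⟨hA, (hinc _).2 h.1⟩).trans (huniq _ ⟨hB, (hinc _).2 h.2⟩).symm)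
    have hor : lab x (insert a x) < lab (insert a x) y ∨
        lab x (insert b x) < lab (insert b x) y := by
      rcases hl.eq_triple hab ha hb with rfl | rfl
      · exact Or.inl ((hinc _).1 hlinc)
      · exact Or.inr ((hinc _).1 hlinc)
    tauto
  have h1 := hperm.mem_iff (a := lab x (insert a x))
  have h2 := hperm.mem_iff (a := lab (insert a x) y)
  simp only [List.mem_cons, List.not_mem_nil, or_false, true_or, or_true, true_iff] at h1 h2
  omega

/-- The label of a covering pair depends only on the added element. -/
lemma IsSdELLabeling.lab_insert (hEL : IsSdELLabeling d lab) {x : Finset (Fin d)} {a : Fin d}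
    (ha : a ∉ x) : lab x (insert a x) = lab ∅ {a} := by
  induction x using Finset.induction_on with
  | empty => simp
  | insert b x hb ih =>
    simp only [Finset.mem_insert, not_or] at ha
    rw [← (hEL.diamond ha.1 ha.2 hb).1, ih ha.2]

lemma IsSdELLabeling.injective (hEL : IsSdELLabeling d lab) :
    Function.Injective fun a => lab ∅ {a} := by
  intro a b h
  by_contra hab
  exact (hEL.diamond (x := ∅) hab (by simp) (by simp)).2 (by simpa using h)

end Labels

section Flags

variable {d : ℕ} {lab : Finset (Fin d) → Finset (Fin d) → ℤ} {F G : ℕ → Finset (Fin d)}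

lemma IsFlag.zero (hF : IsFlag d F) : F 0 = ∅ :=
  Finset.card_eq_zero.1 (hF.card_eq 0 (Nat.zero_le d))

lemma IsFlag.top (hF : IsFlag d F) : F d = Finset.univ :=
  Finset.card_eq_iff_eq_univ _ |>.1 (by simpa using hF.card_eq d le_rfl)

lemma IsFlag.exists_insert (hF : IsFlag d F) {k : ℕ} (hk : k < d) :
    ∃ a ∉ F k, F (k + 1) = insert a (F k) := by
  have h := hF.subset_succ k hk
  have hc : F k ⋖ F (k + 1) := by
    rw [Finset.covBy_iff_card_sdiff_eq_one]
    refine ⟨h, ?_⟩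
    rw [Finset.card_sdiff_of_subset h, hF.card_eq _ hk.le, hF.card_eq _ hk]
    omega
  obtain ⟨a, ha, he⟩ := Finset.covBy_iff_exists_insert.1 hc
  exact ⟨a, ha, he.symm⟩

lemma IsFlag.image_eq (hEL : IsSdELLabeling d lab) (hF : IsFlag d F) {k : ℕ} (hk : k ≤ d) :
    (F k).image (fun a => lab ∅ {a}) = (Finset.range k).image (flagLabel lab F) := by
  induction k with
  | zero => simp [hF.zero]
  | succ k ih =>
    obtain ⟨a, ha, he⟩ := hF.exists_insert hk
    rw [Finset.range_add_one, Finset.image_insert, ← ih (by omega), he, Finset.image_insert,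
      flagLabel, he, hEL.lab_insert ha]

lemma IsFlag.injOn (hEL : IsSdELLabeling d lab) (hF : IsFlag d F) :
    Set.InjOn (flagLabel lab F) (Set.Iio d) := by
  have h : ((Finset.range d).image (flagLabel lab F)).card = (Finset.range d).card := by
    rw [← hF.image_eq hEL le_rfl, Finset.card_image_of_injective _ hEL.injective,
      hF.card_eq d le_rfl, Finset.card_range]
  simpa using Finset.card_image_iff.1 h

lemma IsFlag.image_congr (hEL : IsSdELLabeling d lab) (hF : IsFlag d F) (hG : IsFlag d G)
    {k : ℕ} (hk : k ≤ d) (h : F k = G k) :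
    (Finset.range k).image (flagLabel lab F) = (Finset.range k).image (flagLabel lab G) := by
  rw [← hF.image_eq hEL hk, ← hG.image_eq hEL hk, h]

/-- Every flag can be modified at the ranks in `S` so that its word descends at each of them. -/
lemma IsFlag.exists_descending (hEL : IsSdELLabeling d lab) (hF : IsFlag d F)
    (S : Finset ℕ) :
    ∃ A, IsFlag d A ∧ (∀ k, k ∉ S → F k = A k) ∧
      ∀ k, k + 1 < d → k + 1 ∈ S → flagLabel lab A (k + 1) < flagLabel lab A k := by
  let w : Finset (Fin d) → ℤ := fun x => ∑ a ∈ x, lab ∅ {a}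
  let P : ℤ → Prop := fun z => ∃ A, IsFlag d A ∧ (∀ k, k ∉ S → F k = A k) ∧
    z = ∑ k ∈ Finset.range d, w (A k)
  have hbdd : ∃ b, ∀ z, P z → z ≤ b := by
    refine ⟨∑ k ∈ Finset.range d, ∑ a : Fin d, |lab ∅ {a}|, ?_⟩
    rintro _ ⟨A, -, -, rfl⟩
    refine Finset.sum_le_sum fun k _ => ?_
    exact (Finset.sum_le_sum fun a _ => le_abs_self _).trans
      (Finset.sum_le_sum_of_subset_of_nonneg (Finset.subset_univ _) fun a _ _ => abs_nonneg _)
  obtain ⟨_, ⟨A, hA, hFA, rfl⟩, hmax⟩ := Int.exists_greatest_of_bdd hbdd ⟨_, F, hF, by simp, rfl⟩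
  refine ⟨A, hA, hFA, fun k hk hkS => ?_⟩
  obtain ⟨a, ha, hea⟩ := hA.exists_insert (k := k) (by omega)
  obtain ⟨b, hb, heb⟩ := hA.exists_insert hk
  have hbA : b ∉ A k := fun h => hb (hA.subset_succ k (by omega) h)
  have hab : a ≠ b := by
    rintro rfl
    exact hb (by simp [hea])
  have h1 : flagLabel lab A k = lab ∅ {a} := by rw [flagLabel, hea, hEL.lab_insert ha]
  have h2 : flagLabel lab A (k + 1) = lab ∅ {b} := by rw [flagLabel, heb, hEL.lab_insert hb]
  by_contra hlt
  have hlt : lab ∅ {a} < lab ∅ {b} := by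
    refine lt_of_le_of_ne (by omega) fun h => hab (hEL.injective h)
  set A' := Function.update A (k + 1) (insert b (A k)) with hA'
  have hA'flag : IsFlag d A' := by
    refine ⟨fun j hj => ?_, fun j hj => ?_⟩
    · rcases eq_or_ne j (k + 1) with rfl | hjk
      · simp [hA', Finset.card_insert_of_notMem hbA, hA.card_eq k (by omega)]
      · simp [hA', hjk, hA.card_eq j hj]
    · rcases eq_or_ne j (k + 1) with rfl | hjk
      · simp only [hA', Function.update_self]
        rw [Function.update_of_ne (by omega), heb]
        exact Finset.insert_subset_insert _ (hA.subset_succ k (by omega))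
      · rcases eq_or_ne j k with rfl | hjk'
        · simp [hA']
        · simpa [hA', hjk, hjk'] using hA.subset_succ j hj
  have hle := hmax _ ⟨A', hA'flag, fun j hj => by
    rw [hFA j hj, hA', Function.update_of_ne (by rintro rfl; exact hj hkS)], rfl⟩
  refine absurd hle (not_le.2 (Finset.sum_lt_sum (fun j _ => ?_)
    ⟨k + 1, by simpa using hk, ?_⟩))
  · rcases eq_or_ne j (k + 1) with rfl | hjk
    · simp only [hA', Function.update_self, hea, w, Finset.sum_insert ha, Finset.sum_insert hbA]
      omega
    · simp [hA', hjk]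
  · simp only [hA', Function.update_self, hea, w, Finset.sum_insert ha, Finset.sum_insert hbA]
    omega

end Flags

section Lists

variable {d : ℕ} {lab : Finset (Fin d) → Finset (Fin d) → ℤ} {F : ℕ → Finset (Fin d)}
  {l : List (Finset (Fin d))}

lemma IsFlag.isSatChain (hF : IsFlag d F) :
    IsSatChain (⊥ : Finset (Fin d)) ⊤ ((List.range (d + 1)).map F) := by
  refine isSatChain_iff.2 ⟨?_, ?_, ?_⟩
  · rw [List.isChain_iff_getElem]
    intro i hi
    obtain ⟨a, ha, he⟩ := hF.exists_insert (k := i) (by simpa using hi)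
    simpa [he] using Finset.covBy_insert ha
  · simp [List.range_succ_eq_map, hF.zero]
  · simp [List.range_succ, hF.top]

lemma IsSatChain.exists_flag (hl : IsSatChain (⊥ : Finset (Fin d)) ⊤ l) :
    ∃ F, IsFlag d F ∧ l = (List.range (d + 1)).map F := by
  obtain ⟨hch, hhd, hlast⟩ := isSatChain_iff.1 hl
  have hpos : 0 < l.length := by
    cases l <;> simp at hhd ⊢
  have h0 : l[0] = ⊥ := by
    rw [List.head?_eq_getElem?] at hhd
    simpa [List.getElem?_eq_getElem hpos] using hhd
  rw [List.isChain_iff_getElem] at hch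
  have hcard : ∀ k (hk : k < l.length), l[k].card = k := by
    intro k
    induction k with
    | zero => intro _; simp [h0]
    | succ k ih =>
      intro hk
      obtain ⟨a, ha, he⟩ := Finset.covBy_iff_exists_insert.1 (hch k hk)
      rw [← he, Finset.card_insert_of_notMem ha, ih (by omega)]
  have hlen : l.length = d + 1 := by
    have h1 : l[l.length - 1] = ⊤ := by
      rw [List.getLast?_eq_getElem?] at hlast
      simpa [List.getElem?_eq_getElem (show l.length - 1 < l.length by omega)] using hlast
    have h2 := hcard (l.length - 1) (by omega)
    rw [h1] at h2
    simp at h2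
    omega
  refine ⟨fun k => l.getD k ∅, ⟨fun k hk => ?_, fun k hk => ?_⟩, ?_⟩
  · simp only [List.getD_eq_getElem _ _ (show k < l.length by omega), hcard]
  · simp only [List.getD_eq_getElem _ _ (show k < l.length by omega),
      List.getD_eq_getElem _ _ (show k + 1 < l.length by omega)]
    exact (hch k (by omega)).le
  · refine List.ext_getElem (by simp [hlen]) fun k h _ => ?_
    simp [h]

lemma chainWord_map_range (F : ℕ → Finset (Fin d)) :
    chainWord lab ((List.range (d + 1)).map F) = (List.range d).map (flagLabel lab F) := by
  refine List.ext_getElem (by simp [chainWord]) fun k h _ => ?_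
  simp [chainWord, flagLabel]

lemma getD_map_range {β : Type*} (f : ℕ → β) (b : β) {n k : ℕ} (hk : k < n) :
    ((List.range n).map f).getD k b = f k := by
  simp [hk]

lemma wordDescents_map_range (f : ℕ → ℤ) (n k : ℕ) :
    k ∈ wordDescents ((List.range n).map f) ↔ 1 ≤ k ∧ k < n ∧ f k < f (k - 1) := by
  simp only [wordDescents, Finset.mem_filter, Finset.mem_Icc, List.length_map, List.length_range]
  constructor
  · rintro ⟨⟨h1, h2⟩, h3⟩
    rw [getD_map_range _ _ (by omega), getD_map_range _ _ (by omega)] at h3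
    exact ⟨h1, by omega, h3⟩
  · rintro ⟨h1, h2, h3⟩
    refine ⟨⟨h1, by omega⟩, ?_⟩
    rwa [getD_map_range _ _ (by omega), getD_map_range _ _ (by omega)]

lemma IsFlag.mem_rsel (hF : IsFlag d F) {R : Finset ℕ} {x : Finset (Fin d)} :
    x ∈ rsel d R ((List.range (d + 1)).map F) ↔
      ∃ k ≤ d, (k ∈ R ∨ k = 0 ∨ k = d) ∧ x = F k := by
  simp only [rsel, List.mem_filter, List.mem_map, List.mem_range, decide_eq_true_eq,
    Finset.mem_union, Finset.mem_insert, Finset.mem_singleton]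
  constructor
  · rintro ⟨⟨k, hk, rfl⟩, h⟩
    rw [hF.card_eq k (by omega)] at h
    exact ⟨k, by omega, h, rfl⟩
  · rintro ⟨k, hk, h, rfl⟩
    rw [hF.card_eq k hk]
    exact ⟨⟨k, by omega, rfl⟩, h⟩

lemma IsFlag.rsel_eq_iff (hF : IsFlag d F) {G : ℕ → Finset (Fin d)} (hG : IsFlag d G)
    {R : Finset ℕ} :
    rsel d R ((List.range (d + 1)).map F) = rsel d R ((List.range (d + 1)).map G) ↔
      ∀ k ≤ d, (k ∈ R ∨ k = 0 ∨ k = d) → F k = G k := by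
  constructor
  · intro h k hk hkR
    have hmem : F k ∈ rsel d R ((List.range (d + 1)).map G) := h ▸ hF.mem_rsel.2 ⟨k, hk, hkR, rfl⟩
    obtain ⟨j, hj, -, he⟩ := hG.mem_rsel.1 hmem
    have : k = j := by rw [← hF.card_eq k hk, he, hG.card_eq j hj]
    rw [he, this]
  · intro h
    have key : ∀ {H}, IsFlag d H → rsel d R ((List.range (d + 1)).map H) =
        ((List.range (d + 1)).filter fun k => decide (k ∈ R ∪ ({0, d} : Finset ℕ))).map H := by
      intro H hH
      rw [rsel, List.filter_map]
      congr 1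
      refine List.filter_congr fun k hk => ?_
      simp only [Function.comp_apply, hH.card_eq k (by simpa [Nat.lt_succ_iff] using hk)]
    rw [key hF, key hG]
    refine List.map_congr_left fun k hk => ?_
    simp only [List.mem_filter, List.mem_range, decide_eq_true_eq, Finset.mem_union,
      Finset.mem_insert, Finset.mem_singleton] at hk
    exact h k (by omega) hk.2

lemma IsFlag.rsel_compl_eq_iff (hF : IsFlag d F) {G : ℕ → Finset (Fin d)} (hG : IsFlag d G)
    {S : Finset ℕ} (hS : S ⊆ Finset.Icc 1 (d - 1)) :
    rsel d (Finset.Icc 1 (d - 1) \ S) ((List.range (d + 1)).map F) =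
        rsel d (Finset.Icc 1 (d - 1) \ S) ((List.range (d + 1)).map G) ↔
      ∀ k ≤ d, k ∉ S → F k = G k := by
  rw [hF.rsel_eq_iff hG]
  refine forall_congr' fun k => forall_congr' fun hk => ?_
  have hmem : (k ∈ Finset.Icc 1 (d - 1) \ S ∨ k = 0 ∨ k = d) ↔ k ∉ S := by
    have := @hS k
    simp only [Finset.mem_sdiff, Finset.mem_Icc] at this ⊢
    by_cases hkS : k ∈ S
    · have := this hkS
      simp only [hkS, not_true_eq_false, and_false, false_or, iff_false]
      omega
    · simp only [hkS, not_false_eq_true, and_true, iff_true]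
      omega
  rw [hmem]

/-- Let `U` ascend off `S` and agree with `C` on `S`. If `A` and `B` agree with `U` and `C`
respectively off `S` and `B` descends on `S`, then the word of `B` does not precede that of `A`. -/
lemma IsFlag.not_lex (hEL : IsSdELLabeling d lab) {S : Finset ℕ}
    (hS : S ⊆ Finset.Icc 1 (d - 1)) {U C A B : ℕ → Finset (Fin d)}
    (hU : IsFlag d U) (hC : IsFlag d C) (hA : IsFlag d A) (hB : IsFlag d B)
    (hUC : ∀ k ∈ S, U k = C k) (hUA : ∀ k ≤ d, k ∉ S → U k = A k)
    (hCB : ∀ k ≤ d, k ∉ S → C k = B k)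
    (hasc : ∀ k, k + 1 < d → k + 1 ∉ S → flagLabel lab U k < flagLabel lab U (k + 1))
    (hdesc : ∀ k, k + 1 < d → k + 1 ∈ S → flagLabel lab B (k + 1) < flagLabel lab B k) :
    ¬ List.Lex (· < ·) (chainWord lab ((List.range (d + 1)).map B))
      (chainWord lab ((List.range (d + 1)).map A)) := by
  intro hlex
  rw [chainWord_map_range, chainWord_map_range] at hlex
  obtain ⟨m, hm, heq, hlt⟩ := hlex.exists_getD_lt (by simp)
  have hm : m < d := by simpa using hm
  rw [getD_map_range _ _ hm, getD_map_range _ _ hm] at hlt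
  have hd : d ∉ S := fun h => by
    have := hS h
    simp at this
    omega
  refine not_lex_lt_of_blocks (S := S) (hC.injOn hEL) (hA.injOn hEL) hd
    (fun k hk h => hU.image_congr hEL hC hk ?_)
    (fun k hk h => hU.image_congr hEL hA hk (hUA k hk h))
    (fun k hk h => hC.image_congr hEL hB hk (hCB k hk h)) hasc hdesc hm (fun k hk => ?_) hlt
  · rcases h with h | rfl
    · exact hUC k h
    · rw [hU.top, hC.top]
  · have := heq k hk
    rwa [getD_map_range _ _ (by omega), getD_map_range _ _ (by omega)] at this

end Lists

/-- fix an `S_d`-EL-labeling `λ` of `B_d` and `S ⊆ [d−1]`, and let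
`d_1, …, d_t` (the entries of `D`) be all maximal chains of `B_d` whose `λ`-labels have
descent set `S`, in lexicographic order of their labels, with `L_i`, `Γ_i` as in the
construction.  If `e` is a maximal chain of `L_i`, then `e` is a facet of `Γ_i` if and
only if `(Υ_λ(e))_{[d−1]∖S} = (d_i)_{[d−1]∖S}`. -/
theorem gammaFacet_iff_upsilon (d : ℕ) (lab : Finset (Fin d) → Finset (Fin d) → ℤ)
    (hEL : IsSdELLabeling d lab) (S : Finset ℕ) (hS : S ⊆ Finset.Icc 1 (d - 1))
    (D : List (List (Finset (Fin d))))
    (hD : ∀ l : List (Finset (Fin d)), l ∈ D ↔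
      IsSatChain (⊥ : Finset (Fin d)) (⊤ : Finset (Fin d)) l ∧
        wordDescents (chainWord lab l) = S)
    (hDnd : D.Nodup)
    (hDlex : D.Pairwise fun l l' => List.Lex (· < ·) (chainWord lab l) (chainWord lab l'))
    (i : ℕ) (hi : i < D.length)
    (e : List (Finset (Fin d))) (he : e ∈ Mchain d S D i)
    (u : List (Finset (Fin d))) (hu : IsUpsilon d lab e u) :
    e ∈ GammaFacet d S D i ↔
      rsel d (Finset.Icc 1 (d - 1) \ S) u =
        rsel d (Finset.Icc 1 (d - 1) \ S) (D.getD i []) := by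
  obtain ⟨c, hc, hcD, rfl⟩ := he
  obtain ⟨hu1, hu2, hu3⟩ := hu
  obtain ⟨C, hC, rfl⟩ := hc.exists_flag
  obtain ⟨U, hU, rfl⟩ := hu1.exists_flag
  have hget : ∀ j (hj : j < D.length), D.getD j [] = D[j] := fun j hj =>
    List.getD_eq_getElem _ _ hj
  have hDflag : ∀ j < D.length, ∃ A, IsFlag d A ∧ D.getD j [] = (List.range (d + 1)).map A ∧
      ∀ k, k + 1 < d → k + 1 ∈ S → flagLabel lab A (k + 1) < flagLabel lab A k := by
    intro j hj
    obtain ⟨h1, h2⟩ := (hD (D.getD j [])).1 (by rw [hget j hj]; exact List.getElem_mem hj)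
    obtain ⟨A, hA, hAe⟩ := h1.exists_flag
    refine ⟨A, hA, hAe, fun k _ hkS => ?_⟩
    rw [← h2, hAe, chainWord_map_range, wordDescents_map_range] at hkS
    exact hkS.2.2
  have hlex : ∀ j k, j < k → k < D.length →
      List.Lex (· < ·) (chainWord lab (D.getD j [])) (chainWord lab (D.getD k [])) := by
    intro j k hjk hk
    rw [hget j (by omega), hget k hk]
    exact List.pairwise_iff_getElem.1 hDlex j k (by omega) hk hjk
  have h0S : 0 ∉ S := fun h => by simpa using hS h
  have hdS : d ∉ S := fun h => by
    have := hS h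
    simp at this
    omega
  have hUC : ∀ k ∈ S, U k = C k := by
    intro k hkS
    have hkd : k ≤ d := by
      have := hS hkS
      simp at this
      omega
    have hmem := hu2.subset (hC.mem_rsel.2 ⟨k, hkd, Or.inl hkS, rfl⟩)
    simp only [List.mem_map, List.mem_range] at hmem
    obtain ⟨j, hj, he⟩ := hmem
    have : j = k := by rw [← hC.card_eq k hkd, ← he, hU.card_eq j (by omega)]
    rw [← he, this]
  have hasc : ∀ k, k + 1 < d → k + 1 ∉ S → flagLabel lab U k < flagLabel lab U (k + 1) := by
    intro k hk hkS
    have hne : flagLabel lab U k ≠ flagLabel lab U (k + 1) := fun h => by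
      have := hU.injOn hEL (show k < d by omega) (show k + 1 < d from hk) h
      omega
    by_contra hlt
    have h3 := hu3 k
    rw [chainWord_map_range, getD_map_range _ _ hk, getD_map_range _ _ (by omega),
      getD_map_range _ _ (by omega)] at h3
    obtain ⟨j, hj, hjS, he⟩ := hC.mem_rsel.1 (h3 (by simpa using hk) (by omega))
    have : k + 1 = j := by rw [← hU.card_eq (k + 1) hk.le, he, hC.card_eq j hj]
    subst this
    rcases hjS with h | h | h
    · exact hkS h
    · omega
    · omega
  obtain ⟨B, hB, hBe, hBdesc⟩ := hDflag i hi
  have hCB : ∀ k ≤ d, k ∉ S → C k = B k := by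
    rwa [hBe, hC.rsel_compl_eq_iff hB hS] at hcD
  constructor
  · rintro ⟨-, hnot⟩
    obtain ⟨A, hA, hUA, hAdesc⟩ := hU.exists_descending hEL S
    have hAasc : ∀ k, k + 1 < d → k + 1 ∉ S → flagLabel lab A k < flagLabel lab A (k + 1) :=
      fun k hk hkS => ascent_of_blocks (hU.injOn hEL) h0S hdS
        (fun k hk h => hU.image_congr hEL hA hk (hUA k h)) hasc hAdesc hk hkS
    have hAD : (List.range (d + 1)).map A ∈ D := by
      refine (hD _).2 ⟨hA.isSatChain, ?_⟩
      ext k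
      rw [chainWord_map_range, wordDescents_map_range]
      constructor
      · rintro ⟨h1, h2, h3⟩
        obtain ⟨k, rfl⟩ := Nat.exists_eq_add_of_le' h1
        by_contra hkS
        exact (hAasc k h2 hkS).not_gt (by simpa using h3)
      · intro hkS
        have := hS hkS
        simp only [Finset.mem_Icc] at this
        obtain ⟨k, rfl⟩ := Nat.exists_eq_add_of_le' this.1
        exact ⟨this.1, by omega, by simpa using hAdesc k (by omega) hkS⟩
    obtain ⟨j, hj, hjA⟩ := List.getElem_of_mem hAD
    rw [← hget j hj] at hjA
    have hUj : rsel d (Finset.Icc 1 (d - 1) \ S) ((List.range (d + 1)).map U) =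
        rsel d (Finset.Icc 1 (d - 1) \ S) (D.getD j []) := by
      rw [hjA, hU.rsel_compl_eq_iff hA hS]
      exact fun k _ h => hUA k h
    rcases lt_trichotomy j i with hji | rfl | hij
    · refine absurd ⟨j, hji, fun x hx => ⟨_, ⟨_, hU.isSatChain, hUj, rfl⟩, ?_⟩⟩ hnot
      convert hx using 1
      rw [hU.rsel_eq_iff hC]
      rintro k - (h | rfl | rfl)
      · exact hUC k h
      · rw [hU.zero, hC.zero]
      · rw [hU.top, hC.top]
    · exact hUj
    · refine absurd (hlex i j hij hj) ?_
      rw [hBe, hjA]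
      exact IsFlag.not_lex hEL hS hU hC hA hB hUC (fun k _ h => hUA k h) hCB hasc hBdesc
  · intro hUB
    refine ⟨⟨_, hC.isSatChain, hcD, rfl⟩, ?_⟩
    rintro ⟨j, hji, hj⟩
    obtain ⟨A, hA, hAe, hAdesc⟩ := hDflag j (by omega)
    rw [hBe, hU.rsel_compl_eq_iff hB hS] at hUB
    have hloc : ∀ k ∈ S, ∃ G, IsFlag d G ∧ G k = C k ∧ ∀ r ≤ d, r ∉ S → G r = A r := by
      intro k hkS
      have hkd : k ≤ d := by
        have := hS hkS
        simp at this
        omega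
      obtain ⟨m, ⟨g, hg, hgA, rfl⟩, hm⟩ := hj (C k) (hC.mem_rsel.2 ⟨k, hkd, Or.inl hkS, rfl⟩)
      obtain ⟨G, hG, rfl⟩ := hg.exists_flag
      rw [hAe, hG.rsel_compl_eq_iff hA hS] at hgA
      obtain ⟨r, hr, -, he⟩ := hG.mem_rsel.1 hm
      have : k = r := by rw [← hC.card_eq k hkd, he, hG.card_eq r hr]
      exact ⟨G, hG, by rw [he, this], hgA⟩
    let E : ℕ → Finset (Fin d) := fun k => if k ∈ S then C k else A k
    have hE : IsFlag d E := by
      refine ⟨fun k hk => ?_, fun k hk => ?_⟩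
      · by_cases h : k ∈ S
        · simp [E, h, hC.card_eq k hk]
        · simp [E, h, hA.card_eq k hk]
      · by_cases h : k ∈ S <;> by_cases h' : k + 1 ∈ S
        · simpa [E, h, h'] using hC.subset_succ k hk
        · obtain ⟨G, hG, hGk, hGA⟩ := hloc k h
          simpa [E, h, h', ← hGk, ← hGA (k + 1) hk h'] using hG.subset_succ k hk
        · obtain ⟨G, hG, hGk, hGA⟩ := hloc _ h'
          simpa [E, h, h', ← hGk, ← hGA k hk.le h] using hG.subset_succ k hk
        · simpa [E, h, h'] using hA.subset_succ k hk
    refine absurd (hlex j i hji hi) ?_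
    rw [hAe, hBe]
    exact IsFlag.not_lex hEL hS hU hE hB hA (fun k h => by simp [E, h, hUC k h]) hUB
      (fun k _ h => by simp [E, h]) hasc hAdesc
end

section
/- Fix an S_d-EL-labeling λ of the Boolean lattice B_d and S ⊆ [d−1], and let d_1, …, d_t, L_i, Γ_i be as in the associated construction. Fix i and let e_1, e_2, …, e_m be all maximal chains corresponding to facets of Γ_i, ordered so that λ(Υ_λ(e_k)) lexicographically precedes λ(Υ_λ(e_j)) whenever j < k. Then for all j < k there exists j′ < k such that e_j ∩ e_k ⊆ e_{j′} ∩ e_k = e_{j′} − x for some element x of e_{j′}; in particular this ordering is a shelling of Γ_i. -/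
namespace BooleanFlag

variable {d : ℕ}

/-- A maximal chain of `B_d`, presented as the function sending each rank `n ≤ d` to the element
of that rank. -/
def IsFlag (C : ℕ → Finset (Fin d)) : Prop :=
  (∀ n ≤ d, (C n).card = n) ∧ ∀ n < d, C n ⊆ C (n + 1)

/-- The label of the step from rank `n` to rank `n + 1`. -/
def flagWord (lab : Finset (Fin d) → Finset (Fin d) → ℤ) (C : ℕ → Finset (Fin d)) (n : ℕ) : ℤ :=
  lab (C n) (C (n + 1))

/-- The label of a covering pair `x ⋖ x ∪ {a}` depends only on `a`, injectively. -/
structure IsStandard (lab : Finset (Fin d) → Finset (Fin d) → ℤ) (π : Fin d → ℤ) : Prop where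
  inj : Function.Injective π
  eq : ∀ x a, a ∉ x → lab x (insert a x) = π a

/-- Lexicographic comparison of words at the first rank where the flags differ. -/
def FlagLex (lab : Finset (Fin d) → Finset (Fin d) → ℤ) (C C' : ℕ → Finset (Fin d)) : Prop :=
  ∃ r < d, (∀ n ≤ r, C n = C' n) ∧ flagWord lab C r < flagWord lab C' r

variable {lab : Finset (Fin d) → Finset (Fin d) → ℤ} {π : Fin d → ℤ}
  {C C' : ℕ → Finset (Fin d)}

lemma IsFlag.mono (hC : IsFlag C) {m n : ℕ} (hmn : m ≤ n) (hn : n ≤ d) : C m ⊆ C n := by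
  induction n, hmn using Nat.le_induction with
  | base => exact subset_rfl
  | succ k hk ih => exact (ih (by omega)).trans (hC.2 k (by omega))

lemma IsFlag.zero (hC : IsFlag C) : C 0 = ∅ := by
  simpa using hC.1 0 (by omega)

lemma IsFlag.top (hC : IsFlag C) : C d = Finset.univ :=
  (Finset.card_eq_iff_eq_univ _).1 (by simpa using hC.1 d le_rfl)

lemma IsFlag.exists_insert (hC : IsFlag C) {n : ℕ} (hn : n < d) :
    ∃ a ∉ C n, C (n + 1) = insert a (C n) := by
  have h := (Finset.covBy_iff_card_sdiff_eq_one.2 ⟨hC.2 n hn, by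
    rw [Finset.card_sdiff_of_subset (hC.2 n hn), hC.1 n (by omega), hC.1 (n + 1) (by omega)]
    omega⟩ : C n ⋖ C (n + 1))
  obtain ⟨a, ha, h⟩ := Finset.covBy_iff_exists_insert.1 h
  exact ⟨a, ha, h.symm⟩

lemma IsFlag.exists_step (hC : IsFlag C) (hπ : IsStandard lab π) {n : ℕ} (hn : n < d) :
    ∃ a ∉ C n, C (n + 1) = insert a (C n) ∧ flagWord lab C n = π a := by
  obtain ⟨a, ha, h⟩ := hC.exists_insert hn
  exact ⟨a, ha, h, by rw [flagWord, h, hπ.eq _ _ ha]⟩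

lemma IsFlag.exists_step_of_mem (hC : IsFlag C) (hπ : IsStandard lab π) {n m : ℕ} (hnm : n ≤ m)
    (hm : m ≤ d) {q : Fin d} (hq : q ∈ C m) (hqn : q ∉ C n) :
    ∃ t, n ≤ t ∧ t < m ∧ flagWord lab C t = π q := by
  induction m, hnm using Nat.le_induction with
  | base => exact absurd hq hqn
  | succ k hk ih =>
    by_cases h : q ∈ C k
    · obtain ⟨t, h₁, h₂, h₃⟩ := ih (by omega) h
      exact ⟨t, h₁, by omega, h₃⟩
    · obtain ⟨a, ha, h₁, h₂⟩ := hC.exists_step hπ (n := k) (by omega)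
      rw [h₁, Finset.mem_insert] at hq
      obtain rfl : q = a := hq.resolve_right h
      exact ⟨k, hk, by omega, h₂⟩

lemma IsFlag.word_ne (hC : IsFlag C) (hπ : IsStandard lab π) {m n : ℕ} (hmn : m < n)
    (hn : n < d) : flagWord lab C m ≠ flagWord lab C n := by
  obtain ⟨a, ha, h₁, h₂⟩ := hC.exists_step hπ (n := m) (by omega)
  obtain ⟨b, hb, h₃, h₄⟩ := hC.exists_step hπ hn
  rw [h₂, h₄]
  intro h
  obtain rfl := hπ.inj h
  exact hb (hC.mono hmn hn.le (by simp [h₁]))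

/-- Over a run of ascents the first label is the least. -/
lemma le_of_ascents {w : ℕ → ℤ} {n m : ℕ} (h : ∀ t, n ≤ t → t + 1 < m → w t < w (t + 1)) {t : ℕ}
    (hnt : n ≤ t) (ht : t < m) : w n ≤ w t := by
  induction t, hnt using Nat.le_induction with
  | base => exact le_rfl
  | succ k hk ih => exact (ih (by omega)).trans (h k hk ht).le

/-- Over a run of descents the labels weakly decrease. -/
lemma ge_of_descents {w : ℕ → ℤ} {n m : ℕ} (h : ∀ t, n ≤ t → t + 1 < m → w (t + 1) < w t)
    {s t : ℕ} (hns : n ≤ s) (hst : s ≤ t) (ht : t < m) : w t ≤ w s := by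
  induction t, hst using Nat.le_induction with
  | base => exact le_rfl
  | succ k hk ih => exact (h k (by omega) ht).le.trans (ih (by omega))

lemma flags_eq_or_first_difference (hC : IsFlag C) (hC' : IsFlag C') :
    (∀ n ≤ d, C n = C' n) ∨ ∃ r < d, (∀ n ≤ r, C n = C' n) ∧ C (r + 1) ≠ C' (r + 1) := by
  classical
  by_cases h : ∀ n ≤ d, C n = C' n
  · exact Or.inl h
  · right
    have h' : ∃ n, n ≤ d ∧ C n ≠ C' n := by push Not at h; exact h
    obtain ⟨h₁, h₂⟩ := Nat.find_spec h'
    have h₃ : ∀ n < Nat.find h', C n = C' n := fun n hn => by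
      have := Nat.find_min h' hn
      by_contra h
      exact this ⟨by omega, h⟩
    have h₀ : Nat.find h' ≠ 0 := fun h0 => h₂ (by rw [h0, hC.zero, hC'.zero])
    obtain ⟨r, hr⟩ := Nat.exists_eq_succ_of_ne_zero h₀
    rw [hr] at h₁ h₂ h₃
    exact ⟨r, by omega, fun n hn => h₃ n (by omega), h₂⟩

/-- A flag agreeing with `C` at all ascents of `C` has a lexicographically smaller word. -/
lemma eq_or_flagLex_of_agree_ascents (hC : IsFlag C) (hC' : IsFlag C') (hπ : IsStandard lab π)
    (h : ∀ n, n + 1 < d → flagWord lab C n < flagWord lab C (n + 1) → C (n + 1) = C' (n + 1)) :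
    (∀ n ≤ d, C n = C' n) ∨ FlagLex lab C' C := by
  classical
  obtain h₀ | ⟨r, hr, h₁, h₂⟩ := flags_eq_or_first_difference hC hC'
  · exact Or.inl h₀
  right
  refine ⟨r, hr, fun n hn => (h₁ n hn).symm, ?_⟩
  have hex : ∃ m, r < m ∧ m ≤ d ∧ C m = C' m := ⟨d, hr, le_rfl, by rw [hC.top, hC'.top]⟩
  obtain ⟨hm₁, hm₂, hm₃⟩ := Nat.find_spec hex
  set m := Nat.find hex
  have hmin : ∀ t, r ≤ t → t + 1 < m → flagWord lab C (t + 1) < flagWord lab C t := by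
    intro t ht htm
    have h₃ := Nat.find_min hex htm
    by_contra hcon
    have := hC.word_ne hπ (m := t) (n := t + 1) (by omega) (by omega)
    exact h₃ ⟨by omega, by omega, h t (by omega) (by omega)⟩
  obtain ⟨q, hq, h₃, h₄⟩ := hC'.exists_step hπ hr
  have hqm : q ∈ C m := hm₃ ▸ hC'.mono (m := r + 1) hm₁ hm₂ (by simp [h₃])
  obtain ⟨t, ht₁, ht₂, ht₃⟩ := hC.exists_step_of_mem hπ hm₁.le hm₂ hqm (by rwa [h₁ r le_rfl])
  have hle := ge_of_descents hmin le_rfl ht₁ ht₂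
  rw [h₄, ← ht₃]
  refine lt_of_le_of_ne hle fun heq => h₂ ?_
  obtain ⟨p, hp, h₅, h₆⟩ := hC.exists_step hπ hr
  rw [ht₃, h₆] at heq
  rw [h₅, h₃, h₁ r le_rfl, hπ.inj heq]

/-- Exchanging the two steps around an inner rank. -/
lemma IsFlag.exists_swap (hC : IsFlag C) (hπ : IsStandard lab π) {n : ℕ} (hn : n + 1 < d) :
    ∃ C' : ℕ → Finset (Fin d), IsFlag C' ∧ (∀ m, m ≠ n + 1 → C' m = C m) ∧
      C' (n + 1) ≠ C (n + 1) ∧ flagWord lab C' n = flagWord lab C (n + 1) ∧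
      flagWord lab C' (n + 1) = flagWord lab C n := by
  obtain ⟨a, ha, h₁, h₂⟩ := hC.exists_step hπ (n := n) (by omega)
  obtain ⟨b, hb, h₃, h₄⟩ := hC.exists_step hπ hn
  have hab : a ≠ b := by rintro rfl; exact hb (by simp [h₁])
  have hbn : b ∉ C n := fun h => hb (by simp [h₁, h])
  have hC' : ∀ m, m ≠ n + 1 → Function.update C (n + 1) (insert b (C n)) m = C m :=
    fun m hm => Function.update_of_ne hm _ _
  have hC'n : Function.update C (n + 1) (insert b (C n)) (n + 1) = insert b (C n) := by simp
  have hsq : C (n + 2) = insert a (insert b (C n)) := by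
    rw [show n + 2 = n + 1 + 1 from rfl, h₃, h₁, Finset.insert_comm]
  refine ⟨Function.update C (n + 1) (insert b (C n)), ⟨fun m hm => ?_, fun m hm => ?_⟩, hC', ?_,
    ?_, ?_⟩
  · by_cases h : m = n + 1
    · subst h
      rw [hC'n, Finset.card_insert_of_notMem hbn, hC.1 n (by omega)]
    · rw [hC' m h, hC.1 m hm]
  · by_cases h : m = n + 1
    · subst h
      rw [hC'n, hC' _ (by omega), hsq]
      exact Finset.subset_insert _ _
    · rw [hC' m h]
      by_cases h' : m = n
      · subst h'
        rw [hC'n]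
        exact Finset.subset_insert _ _
      · rw [hC' _ (by omega)]
        exact hC.2 m hm
  · rw [hC'n, h₁]
    intro h
    have : a ∈ insert b (C n) := h ▸ Finset.mem_insert_self _ _
    rw [Finset.mem_insert] at this
    exact this.elim hab ha
  · rw [h₄, flagWord, hC'n, hC' n (by omega), hπ.eq _ _ hbn]
  · rw [h₂, flagWord, hC'n, hC' (n + 1 + 1) (by omega), hsq,
      hπ.eq _ _ (by simp [hab, ha])]

/-- If `C` is obtained from its elements of rank in `S` by increasing filling, then the flag with
descent set `S` attached to `C` precedes those attached to other flags through these elements. -/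
lemma eq_or_flagLex_of_descentSet {S : Finset ℕ} {δ δ' : ℕ → Finset (Fin d)} (hC : IsFlag C)
    (hC' : IsFlag C') (hδ : IsFlag δ) (hδ' : IsFlag δ') (hπ : IsStandard lab π)
    (hS : ∀ n ∈ S, n ≤ d → C n = C' n)
    (hasc : ∀ n, n + 1 < d → n + 1 ∉ S → flagWord lab C n < flagWord lab C (n + 1))
    (hCδ : ∀ n ∉ S, n ≤ d → C n = δ n) (hCδ' : ∀ n ∉ S, n ≤ d → C' n = δ' n)
    (hdes : ∀ n, n + 1 < d → n + 1 ∈ S → flagWord lab δ (n + 1) < flagWord lab δ n)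
    (hdes' : ∀ n, n + 1 < d → n + 1 ∈ S → flagWord lab δ' (n + 1) < flagWord lab δ' n) :
    (∀ n ≤ d, C n = C' n) ∨ FlagLex lab δ δ' := by
  classical
  obtain h₀ | ⟨r, hr, h₁, h₂⟩ := flags_eq_or_first_difference hδ hδ'
  · left
    intro n hn
    by_cases h : n ∈ S
    · exact hS n h hn
    · rw [hCδ n h hn, h₀ n hn, hCδ' n h hn]
  right
  refine ⟨r, hr, h₁, ?_⟩
  obtain ⟨u, hu, hu₁, hu₂⟩ := hδ.exists_step hπ hr
  obtain ⟨v, hv, hv₁, hv₂⟩ := hδ'.exists_step hπ hr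
  have huv : u ≠ v := by
    rintro rfl
    exact h₂ (by rw [hu₁, hv₁, h₁ r le_rfl])
  have hex : ∃ b, r ≤ b ∧ (b + 1 ∉ S ∨ b + 1 = d) := ⟨d - 1, by omega, by omega⟩
  obtain ⟨hb₁, hb₂⟩ := Nat.find_spec hex
  have hbS : ∀ n, r < n → n ≤ Nat.find hex → n ∈ S ∧ n ≠ d := by
    intro n hn hn'
    have := Nat.find_min hex (m := n - 1) (by omega)
    rw [show n - 1 + 1 = n by omega] at this
    by_contra h
    exact this ⟨by omega, by tauto⟩
  have hbd : Nat.find hex < d := by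
    by_contra h
    exact (hbS d hr (by omega)).2 rfl
  set b := Nat.find hex
  have hδb : C (b + 1) = δ (b + 1) := by
    rcases hb₂ with h | h
    · exact hCδ _ h hbd
    · rw [h, hC.top, hδ.top]
  have hδb' : C' (b + 1) = δ' (b + 1) := by
    rcases hb₂ with h | h
    · exact hCδ' _ h hbd
    · rw [h, hC'.top, hδ'.top]
  have hY : C b = C' b := by
    by_cases h : b ∈ S
    · exact hS b h hbd.le
    · have : b ≤ r := by
        by_contra h'
        exact h (hbS b (by omega) le_rfl).1
      rw [hCδ b h hbd.le, hCδ' b h hbd.le, h₁ b this]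
  have hmax : ∀ q ∈ C' (b + 1), q ∉ δ r → π q ≤ π v := by
    intro q hq hqr
    rw [hδb'] at hq
    rw [h₁ r le_rfl] at hqr
    obtain ⟨t, ht₁, ht₂, ht₃⟩ :=
      hδ'.exists_step_of_mem hπ (n := r) (m := b + 1) (by omega) hbd hq hqr
    rw [← ht₃, ← hv₂]
    exact ge_of_descents (m := b + 1)
      (fun t h₃ h₄ => hdes' t (by omega) (hbS (t + 1) (by omega) (by omega)).1) le_rfl ht₁ ht₂
  have hmaxδ : ∀ q ∈ C (b + 1), q ∉ δ r → π q ≤ π u := by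
    intro q hq hqr
    rw [hδb] at hq
    obtain ⟨t, ht₁, ht₂, ht₃⟩ :=
      hδ.exists_step_of_mem hπ (n := r) (m := b + 1) (by omega) hbd hq hqr
    rw [← ht₃, ← hu₂]
    exact ge_of_descents (m := b + 1)
      (fun t h₃ h₄ => hdes t (by omega) (hbS (t + 1) (by omega) (by omega)).1) le_rfl ht₁ ht₂
  obtain ⟨p, hp, hp₁, hp₂⟩ := hC.exists_step hπ hbd
  obtain ⟨q, hq, hq₁, hq₂⟩ := hC'.exists_step hπ hbd
  have huC : u ∈ C (b + 1) := hδb ▸ hδ.mono (m := r + 1) (by omega) hbd (by simp [hu₁])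
  have hvC : v ∈ C' (b + 1) := hδb' ▸ hδ'.mono (m := r + 1) (by omega) hbd (by simp [hv₁])
  rw [← h₁ r le_rfl] at hv
  rw [hu₂, hv₂]
  have hpq : p ≠ q := by
    rintro rfl
    have : C (b + 1) = C' (b + 1) := by rw [hp₁, hq₁, hY]
    exact huv (hπ.inj (le_antisymm (hmax u (this ▸ huC) hu) (hmaxδ v (this ▸ hvC) hv)))
  have hlt : π p < π q := by
    have hexs : ∃ s, b + 1 ≤ s ∧ s ≤ d ∧ C s = C' s := ⟨d, hbd, le_rfl, by rw [hC.top, hC'.top]⟩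
    obtain ⟨hs₁, hs₂, hs₃⟩ := Nat.find_spec hexs
    have hsS : ∀ n, b + 1 ≤ n → n < Nat.find hexs → n ∉ S := by
      intro n hn hn' hnS
      exact Nat.find_min hexs hn' ⟨hn, by omega, hS n hnS (by omega)⟩
    set s := Nat.find hexs
    have hqs : q ∈ C s := hs₃ ▸ hC'.mono hs₁ hs₂ (by simp [hq₁])
    have hqC : q ∉ C b := by rwa [hY]
    obtain ⟨t, ht₁, ht₂, ht₃⟩ := hC.exists_step_of_mem hπ (by omega) hs₂ hqs hqC
    rw [← ht₃, ← hp₂]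
    refine lt_of_le_of_ne (le_of_ascents (m := s) (fun t h₃ h₄ => hasc t (by omega)
      (hsS _ (by omega) h₄)) ht₁ ht₂) ?_
    rw [ht₃, hp₂]
    exact fun h => hpq (hπ.inj h)
  refine lt_of_le_of_ne ?_ fun h => huv (hπ.inj h)
  by_cases hup : u = p
  · subst hup
    refine hlt.le.trans (hmax q (by simp [hq₁]) fun hqr => ?_)
    have : q ∈ C (b + 1) := hδb ▸ hδ.mono (by omega) hbd hqr
    rw [hp₁, Finset.mem_insert, hY] at this
    exact this.elim (fun h => hpq h.symm) hq
  · refine hmax u ?_ hu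
    rw [hp₁, Finset.mem_insert] at huC
    rw [hq₁, ← hY]
    exact Finset.mem_insert_of_mem (huC.resolve_left hup)

/-- The list of elements of a flag. -/
def flagList (C : ℕ → Finset (Fin d)) : List (Finset (Fin d)) := (List.range (d + 1)).map C

lemma flagList_getD {n : ℕ} (hn : n ≤ d) (x : Finset (Fin d)) : (flagList C).getD n x = C n := by
  rw [List.getD_eq_getElem _ _ (by simp [flagList]; omega)]
  simp [flagList]

lemma flagList_eq_iff : flagList C = flagList C' ↔ ∀ n ≤ d, C n = C' n := by
  simp [flagList]

lemma mem_flagList (hC : IsFlag C) {x : Finset (Fin d)} : x ∈ flagList C ↔ x = C x.card := by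
  simp only [flagList, List.mem_map, List.mem_range, Nat.lt_succ_iff]
  constructor
  · rintro ⟨n, hn, rfl⟩
    rw [hC.1 n hn]
  · intro h
    exact ⟨x.card, by simpa using Finset.card_le_univ x, h.symm⟩

lemma mem_rsel_flagList (hC : IsFlag C) {R : Finset ℕ} {x : Finset (Fin d)} :
    x ∈ rsel d R (flagList C) ↔ x.card ∈ R ∪ ({0, d} : Finset ℕ) ∧ x = C x.card := by
  rw [rsel, List.mem_filter, mem_flagList hC, decide_eq_true_iff, and_comm]

lemma rsel_flagList_eq_iff (hC : IsFlag C) (hC' : IsFlag C') {R : Finset ℕ} :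
    rsel d R (flagList C) = rsel d R (flagList C') ↔ ∀ n ∈ R, n ≤ d → C n = C' n := by
  constructor
  · intro h n hn hnd
    have : C n ∈ rsel d R (flagList C) :=
      (mem_rsel_flagList hC).2 (by rw [hC.1 n hnd]; simp [hn])
    rw [h, mem_rsel_flagList hC', hC.1 n hnd] at this
    exact this.2
  · intro h
    have key : ∀ {C : ℕ → Finset (Fin d)}, IsFlag C → rsel d R (flagList C) =
        ((List.range (d + 1)).filter fun n => decide (n ∈ R ∪ ({0, d} : Finset ℕ))).map C := by
      intro C hC
      rw [rsel, flagList, List.filter_map]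
      congr 1
      refine List.filter_congr fun n hn => ?_
      rw [Function.comp_apply, hC.1 n (by simpa [Nat.lt_succ_iff] using hn)]
    rw [key hC, key hC']
    refine List.map_congr_left fun n hn => ?_
    simp only [List.mem_filter, List.mem_range, Nat.lt_succ_iff, decide_eq_true_iff,
      Finset.mem_union, Finset.mem_insert, Finset.mem_singleton] at hn
    rcases hn with ⟨hn, hR | rfl | rfl⟩
    · exact h n hR hn
    · rw [hC.zero, hC'.zero]
    · rw [hC.top, hC'.top]

lemma rsel_compl_flagList_eq_iff (hC : IsFlag C) (hC' : IsFlag C') {S : Finset ℕ} :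
    rsel d (Finset.Icc 1 (d - 1) \ S) (flagList C) =
      rsel d (Finset.Icc 1 (d - 1) \ S) (flagList C') ↔ ∀ n ∉ S, n ≤ d → C n = C' n := by
  rw [rsel_flagList_eq_iff hC hC']
  refine ⟨fun h n hn hnd => ?_, fun h n hn => h n (Finset.mem_sdiff.1 hn).2⟩
  by_cases h₀ : n = 0
  · rw [h₀, hC.zero, hC'.zero]
  by_cases h₁ : n = d
  · rw [h₁, hC.top, hC'.top]
  exact h n (Finset.mem_sdiff.2 ⟨Finset.mem_Icc.2 ⟨by omega, by omega⟩, hn⟩) hnd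

lemma isSatChain_flagList (hC : IsFlag C) :
    IsSatChain (⊥ : Finset (Fin d)) (⊤ : Finset (Fin d)) (flagList C) := by
  refine ⟨?_, ?_, ?_⟩
  · refine List.isChain_iff_getElem.2 fun n hn => ?_
    simp only [flagList, List.length_map, List.length_range, List.getElem_map,
      List.getElem_range] at hn ⊢
    obtain ⟨a, ha, h⟩ := hC.exists_insert (n := n) (by omega)
    rw [h]
    exact Finset.covBy_insert ha
  · simp [flagList, List.head?_range, hC.zero]
  · simp [flagList, List.getLast?_range, hC.top]

lemma card_getElem_of_isSatChain {x y : Finset (Fin d)} {l : List (Finset (Fin d))}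
    (h : IsSatChain x y l) {n : ℕ} (hn : n < l.length) : l[n].card = x.card + n := by
  obtain ⟨h₁, h₂, -⟩ := h
  induction n with
  | zero =>
    rw [List.head?_eq_getElem?, List.getElem?_eq_getElem hn] at h₂
    simpa using congrArg Finset.card (Option.some.inj h₂)
  | succ n ih =>
    have h₃ := List.isChain_iff_getElem.1 h₁ n hn
    obtain ⟨h₄, h₅⟩ := Finset.covBy_iff_card_sdiff_eq_one.1 h₃
    rw [Finset.card_sdiff_of_subset h₄] at h₅
    have := ih (by omega)
    omega

lemma length_of_isSatChain {x y : Finset (Fin d)} {l : List (Finset (Fin d))}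
    (h : IsSatChain x y l) : x.card + l.length = y.card + 1 := by
  have h₃ := h.2.2
  rw [List.getLast?_eq_getElem?] at h₃
  obtain ⟨h₄, h₅⟩ := List.getElem?_eq_some_iff.1 h₃
  have := card_getElem_of_isSatChain h h₄
  rw [h₅] at this
  omega

lemma exists_flag_of_isSatChain {l : List (Finset (Fin d))}
    (h : IsSatChain (⊥ : Finset (Fin d)) (⊤ : Finset (Fin d)) l) :
    ∃ C, IsFlag C ∧ l = flagList C := by
  have hlen : l.length = d + 1 := by simpa using length_of_isSatChain h
  have hget : ∀ n, (hn : n < l.length) → l.getD n ⊥ = l[n] :=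
    fun n hn => List.getD_eq_getElem _ _ hn
  refine ⟨fun n => l.getD n ⊥, ⟨fun n hn => ?_, fun n hn => ?_⟩, ?_⟩
  · simp only
    rw [hget n (by omega), card_getElem_of_isSatChain h]
    simp
  · simp only
    rw [hget n (by omega), hget (n + 1) (by omega)]
    exact (List.isChain_iff_getElem.1 h.1 n (by omega)).le
  · refine List.ext_getElem (by simp [flagList, hlen]) fun n h₁ h₂ => ?_
    simp only [flagList, List.getElem_map, List.getElem_range]
    rw [hget n h₁]

lemma chainWord_flagList :
    chainWord lab (flagList C) = (List.range d).map (flagWord lab C) := by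
  refine List.ext_getElem (by simp [chainWord, flagList]) fun n h₁ h₂ => ?_
  simp [chainWord, flagList, flagWord]

lemma getD_map_range {w : ℕ → ℤ} {n : ℕ} (hn : n < d) (z : ℤ) :
    ((List.range d).map w).getD n z = w n := by
  rw [List.getD_eq_getElem _ _ (by simpa using hn)]
  simp

lemma wordDescents_flagList_eq_iff {S : Finset ℕ} (hS : S ⊆ Finset.Icc 1 (d - 1)) :
    wordDescents (chainWord lab (flagList C)) = S ↔
      ∀ n, n + 1 < d → (n + 1 ∈ S ↔ flagWord lab C (n + 1) < flagWord lab C n) := by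
  rw [chainWord_flagList, wordDescents, Finset.ext_iff]
  simp only [Finset.mem_filter, List.length_map, List.length_range, Finset.mem_Icc]
  constructor
  · intro h n hn
    rw [← h, getD_map_range hn, Nat.add_sub_cancel, getD_map_range (by omega)]
    exact and_iff_right ⟨by omega, by omega⟩
  · intro h n
    by_cases hn : 1 ≤ n ∧ n ≤ d - 1
    · obtain ⟨m, rfl⟩ := Nat.exists_eq_add_of_le' hn.1
      rw [and_iff_right hn, h m (by omega), getD_map_range (by omega), Nat.add_sub_cancel,
        getD_map_range (by omega)]
    · exact ⟨fun h => absurd h.1 hn, fun h => absurd (Finset.mem_Icc.1 (hS h)) hn⟩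

lemma lex_of_flagLex (h : FlagLex lab C C') :
    List.Lex (· < ·) (chainWord lab (flagList C)) (chainWord lab (flagList C')) := by
  obtain ⟨r, hr, h₁, h₂⟩ := h
  rw [chainWord_flagList, chainWord_flagList, List.lex_lt, List.lt_iff_exists]
  refine Or.inr ⟨r, by simpa using hr, by simpa using hr, fun j hj => ?_, by simpa using h₂⟩
  simp only [List.getElem_map, List.getElem_range, flagWord]
  rw [h₁ j (by omega), h₁ (j + 1) (by omega)]

lemma exists_flag_through {x : Finset (Fin d)} {a b : Fin d} (ha : a ∉ x) (hb : b ∉ x)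
    (hab : a ≠ b) : x.card + 1 < d ∧ ∃ C : ℕ → Finset (Fin d), IsFlag C ∧ C x.card = x ∧
      C (x.card + 1) = insert a x ∧ C (x.card + 2) = insert b (insert a x) := by
  classical
  set L : List (Fin d) := x.toList ++ a :: b :: (insert a (insert b x))ᶜ.toList with hL
  have hnd : L.Nodup := by
    rw [hL, List.nodup_append']
    refine ⟨x.nodup_toList, ?_, ?_⟩
    · simp [hab, Finset.nodup_toList]
    · intro z hz hz'
      simp only [Finset.mem_toList, List.mem_cons, Finset.mem_compl, Finset.mem_insert] at hz hz'
      rcases hz' with rfl | rfl | h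
      · exact ha hz
      · exact hb hz
      · exact h (Or.inr (Or.inr hz))
  have hmem : ∀ z, z ∈ L := by
    intro z
    simp only [hL, List.mem_append, Finset.mem_toList, List.mem_cons, Finset.mem_compl,
      Finset.mem_insert]
    tauto
  have hlen : L.length = d := by
    rw [← List.toFinset_card_of_nodup hnd, show L.toFinset = Finset.univ by ext z; simp [hmem]]
    simp
  have hx : x.toList.length = x.card := x.length_toList
  refine ⟨?_, fun n => (L.take n).toFinset, ⟨fun n hn => ?_, fun n hn => ?_⟩, ?_, ?_, ?_⟩
  · have : L.length = x.card + ((insert a (insert b x))ᶜ.toList.length + 2) := by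
      rw [hL, List.length_append, hx]
      rfl
    omega
  · simp only
    rw [List.toFinset_card_of_nodup (hnd.sublist (List.take_sublist _ _)), List.length_take]
    omega
  · exact fun z hz => by
      simp only [List.mem_toFinset] at hz ⊢
      exact (List.take_sublist_take_left (Nat.le_succ n)).subset hz
  · simp only
    rw [← hx, hL, List.take_left]
    simp
  · simp only
    rw [← hx, hL, List.take_length_add_append]
    ext z
    simp
  · simp only
    rw [← hx, hL, List.take_length_add_append]
    ext z
    simp only [List.take_succ_cons, List.take_zero, List.toFinset_append, List.toFinset_cons,
      List.toFinset_nil, Finset.toList_toFinset, Finset.mem_union, Finset.mem_insert,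
      Finset.notMem_empty]
    tauto

lemma word_perm (h : IsSdELLabeling d lab) (hC : IsFlag C) (hC' : IsFlag C') :
    ((List.range d).map (flagWord lab C)).Perm ((List.range d).map (flagWord lab C')) := by
  rw [← chainWord_flagList, ← chainWord_flagList]
  exact (h.2 _ (isSatChain_flagList hC)).trans (h.2 _ (isSatChain_flagList hC')).symm

lemma word_nodup (h : IsSdELLabeling d lab) (hC : IsFlag C) :
    ((List.range d).map (flagWord lab C)).Nodup := by
  rw [← chainWord_flagList, (h.2 _ (isSatChain_flagList hC)).nodup_iff]
  simp only [List.bind_eq_flatMap, List.pure_def, List.map_map, ← List.map_eq_flatMap]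
  exact List.nodup_range.map fun i j hij => by simpa using hij

lemma isSatChain_triple {x : Finset (Fin d)} {a b : Fin d} (ha : a ∉ x) (hb : b ∉ x)
    (hab : a ≠ b) : IsSatChain x (insert b (insert a x)) [x, insert a x, insert b (insert a x)] :=
  ⟨List.isChain_cons_cons.2 ⟨Finset.covBy_insert ha, List.isChain_cons_cons.2
    ⟨Finset.covBy_insert (by simp [hab.symm, hb]), List.isChain_singleton _⟩⟩, rfl, rfl⟩

lemma eq_triple_of_isSatChain {x : Finset (Fin d)} {a b : Fin d} (ha : a ∉ x) (hb : b ∉ x)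
    (hab : a ≠ b) {l : List (Finset (Fin d))} (h : IsSatChain x (insert b (insert a x)) l) :
    l = [x, insert a x, insert b (insert a x)] ∨ l = [x, insert b x, insert b (insert a x)] := by
  have hlen := length_of_isSatChain h
  rw [Finset.card_insert_of_notMem (by simp [hab.symm, hb]), Finset.card_insert_of_notMem ha]
    at hlen
  obtain ⟨p, y, q, rfl⟩ := List.length_eq_three.1 (show l.length = 3 by omega)
  obtain ⟨h₁, h₂, h₃⟩ := h
  obtain rfl : p = x := by simpa using h₂
  obtain rfl : q = insert b (insert a p) := by simpa using h₃
  obtain ⟨h₄, h₅⟩ := List.isChain_cons_cons.1 h₁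
  obtain ⟨h₆, -⟩ := List.isChain_cons_cons.1 h₅
  obtain ⟨c, hc, rfl⟩ := Finset.covBy_iff_exists_insert.1 h₄
  have : c ∈ insert b (insert a p) := h₆.le (Finset.mem_insert_self _ _)
  simp only [Finset.mem_insert] at this
  rcases this with rfl | rfl | h
  · exact Or.inr rfl
  · exact Or.inl rfl
  · exact absurd h hc

lemma lab_insert_comm (h : IsSdELLabeling d lab) {x : Finset (Fin d)} {a b : Fin d} (ha : a ∉ x)
    (hb : b ∉ x) (hab : a ≠ b) :
    lab x (insert a x) = lab (insert b x) (insert a (insert b x)) ∧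
      lab x (insert a x) ≠ lab (insert a x) (insert b (insert a x)) := by
  obtain ⟨hd, C, hC, h₁, h₂, h₃⟩ := exists_flag_through ha hb hab
  set n := x.card with hn
  have hbx : (insert b x).card = n + 1 := Finset.card_insert_of_notMem hb
  set C' := Function.update C (n + 1) (insert b x) with hC'
  have hne : ∀ m, m ≠ n + 1 → C' m = C m := fun m hm => Function.update_of_ne hm _ _
  have heq : C' (n + 1) = insert b x := by simp [hC']
  have hCf : IsFlag C' := by
    refine ⟨fun m hm => ?_, fun m hm => ?_⟩
    · by_cases hmn : m = n + 1
      · rw [hmn, heq, hbx]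
      · rw [hne m hmn, hC.1 m hm]
    · by_cases hmn : m = n + 1
      · rw [hmn, heq, hne _ (by omega), h₃]
        exact Finset.insert_subset_insert _ (Finset.subset_insert _ _)
      · rw [hne m hmn]
        by_cases hmn' : m = n
        · rw [hmn', heq, h₁]
          exact Finset.subset_insert _ _
        · rw [hne _ (by omega)]
          exact hC.2 m hm
  have hsum : ∀ f : ℤ → ℤ, f (flagWord lab C n) + f (flagWord lab C (n + 1)) =
      f (flagWord lab C' n) + f (flagWord lab C' (n + 1)) := by
    intro f
    have hp := ((word_perm h hC hCf).map f).sum_eq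
    rw [List.map_map, List.map_map, ← List.sum_toFinset _ List.nodup_range,
      ← List.sum_toFinset _ List.nodup_range, List.toFinset_range, ← sub_eq_zero,
      ← Finset.sum_sub_distrib, Finset.sum_eq_add_of_mem n (n + 1)
        (Finset.mem_range.2 (by omega)) (Finset.mem_range.2 hd) (by omega)] at hp
    · simp only [Function.comp_apply] at hp
      linarith
    · intro m hm hm'
      simp only [Function.comp_apply, flagWord]
      rw [hne m hm'.2, hne (m + 1) (by omega), sub_self]
  have hinj : flagWord lab C n ≠ flagWord lab C (n + 1) := by
    intro heq
    have := List.inj_on_of_nodup_map (word_nodup h hC) (List.mem_range.2 (by omega : n < d))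
      (List.mem_range.2 hd) heq
    omega
  have hw₁ : flagWord lab C n = lab x (insert a x) := by rw [flagWord, h₁, h₂]
  have hw₂ : flagWord lab C (n + 1) = lab (insert a x) (insert b (insert a x)) := by
    rw [flagWord, h₂, h₃]
  have hw₃ : flagWord lab C' n = lab x (insert b x) := by
    rw [flagWord, heq, hne n (by omega), h₁]
  have hw₄ : flagWord lab C' (n + 1) = lab (insert b x) (insert b (insert a x)) := by
    rw [flagWord, heq, hne (n + 2) (by omega), h₃]
  rw [hw₁, hw₂] at hinj
  rw [hw₁, hw₂, hw₃, hw₄] at hsum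
  rw [Finset.insert_comm a b x]
  refine ⟨?_, hinj⟩
  by_contra hcon
  have hs₁ := hsum id
  have hs₂ := hsum fun z => z ^ 2
  simp only [id] at hs₁ hs₂
  have hprod : 2 * ((lab x (insert a x) - lab (insert b x) (insert b (insert a x))) *
      (lab x (insert a x) - lab x (insert b x))) = 0 := by
    linear_combination (lab x (insert a x) - lab (insert a x) (insert b (insert a x)) -
      lab x (insert b x) - lab (insert b x) (insert b (insert a x))) * hs₁ + hs₂
  have hp : lab x (insert a x) = lab x (insert b x) := by
    rcases mul_eq_zero.1 ((mul_eq_zero.1 hprod).resolve_left two_ne_zero) with h' | h'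
    · exact absurd (sub_eq_zero.1 h') hcon
    · exact sub_eq_zero.1 h'
  have hq : lab (insert a x) (insert b (insert a x)) =
      lab (insert b x) (insert b (insert a x)) := by linarith
  have hT₁ := isSatChain_triple ha hb hab
  have hT₂ := isSatChain_triple hb ha hab.symm
  rw [Finset.insert_comm a b x] at hT₂
  have hinc : ∀ y, (chainWord lab [x, y, insert b (insert a x)]).IsChain (· < ·) ↔
      lab x y < lab y (insert b (insert a x)) := by
    intro y
    simp [chainWord]
  obtain ⟨⟨l, ⟨hl₁, hl₂⟩, huniq⟩, -⟩ := h.1 x (insert b (insert a x))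
    ((Finset.subset_insert _ _).trans (Finset.subset_insert _ _))
  have hlt : lab x (insert a x) < lab (insert a x) (insert b (insert a x)) := by
    rcases eq_triple_of_isSatChain ha hb hab hl₁ with rfl | rfl
    · exact (hinc _).1 hl₂
    · rw [hp, hq]
      exact (hinc _).1 hl₂
  have heq₁ := huniq _ ⟨hT₁, (hinc _).2 hlt⟩
  have heq₂ := huniq _ ⟨hT₂, (hinc _).2 (by rwa [← hp, ← hq])⟩
  have heq₃ : insert a x = insert b x := by
    rw [← heq₂] at heq₁
    simpa using heq₁
  have : a ∈ insert b x := heq₃ ▸ Finset.mem_insert_self _ _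
  rw [Finset.mem_insert] at this
  exact this.elim hab ha

lemma exists_isStandard (h : IsSdELLabeling d lab) : ∃ π, IsStandard lab π := by
  refine ⟨fun a => lab ∅ {a}, ⟨fun a b hab => ?_, fun x a ha => ?_⟩⟩
  · by_contra hne
    have h₁ := lab_insert_comm h (x := ∅) (by simp) (by simp) hne
    have h₂ := lab_insert_comm h (x := ∅) (by simp) (by simp) (Ne.symm hne)
    refine h₁.2 ?_
    rw [← h₂.1]
    simpa using hab
  · induction x using Finset.induction_on with
    | empty => simp
    | insert b x hb ih =>
      simp only [Finset.mem_insert, not_or] at ha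
      rw [← (lab_insert_comm h ha.2 hb ha.1).1, ih ha.2]

/-- Reordering decreasingly between the ranks outside `S` a flag ascending at these ranks gives
a flag with descent set `S`. -/
lemma exists_flag_descentSet (hC : IsFlag C) (hπ : IsStandard lab π) {S : Finset ℕ}
    (hasc : ∀ n, n + 1 < d → n + 1 ∉ S → flagWord lab C n < flagWord lab C (n + 1)) :
    ∃ δ : ℕ → Finset (Fin d), IsFlag δ ∧ (∀ n ∉ S, n ≤ d → C n = δ n) ∧
      ∀ n, n + 1 < d → (n + 1 ∈ S ↔ flagWord lab δ (n + 1) < flagWord lab δ n) := by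
  classical
  have hfin : {l : List (Finset (Fin d)) | ∃ δ, IsFlag δ ∧ (∀ n ∉ S, n ≤ d → C n = δ n) ∧
      l = flagList δ}.Finite := by
    refine (List.finite_length_eq (Finset (Fin d)) (d + 1)).subset ?_
    rintro _ ⟨δ, -, -, rfl⟩
    simp [flagList]
  obtain ⟨_, ⟨δ, hδ, hCδ, rfl⟩, hmax⟩ := Set.exists_max_image _ (chainWord lab) hfin
    ⟨_, C, hC, fun _ _ _ => rfl, rfl⟩
  have hdes : ∀ n, n + 1 < d → n + 1 ∈ S → flagWord lab δ (n + 1) < flagWord lab δ n := by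
    intro n hn hnS
    by_contra hcon
    have hlt := lt_of_le_of_ne (not_lt.1 hcon) (hδ.word_ne hπ (Nat.lt_succ_self n) hn)
    obtain ⟨δ', hδ', h₁, h₂, h₃, -⟩ := hδ.exists_swap hπ hn
    refine not_lt.2 (hmax _ ⟨δ', hδ', fun m hm hmd => ?_, rfl⟩)
      (List.lex_lt.1 (lex_of_flagLex ⟨n, by omega, fun m hm => ?_, ?_⟩))
    · rw [hCδ m hm hmd, h₁]
      rintro rfl
      exact hm hnS
    · rw [h₁ m (by omega)]
    · rwa [h₃]
  refine ⟨δ, hδ, hCδ, fun n hn => ⟨hdes n hn, fun hlt => ?_⟩⟩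
  by_contra hnS
  have ha₀ : Nat.findGreatest (fun a => a ∉ S ∨ a = 0) n ∉ S ∨
      Nat.findGreatest (fun a => a ∉ S ∨ a = 0) n = 0 :=
    Nat.findGreatest_spec (P := fun a => a ∉ S ∨ a = 0) (Nat.zero_le n) (Or.inr rfl)
  have ha₁ := Nat.findGreatest_le (P := fun a => a ∉ S ∨ a = 0) n
  have ha₂ : ∀ k, Nat.findGreatest (fun a => a ∉ S ∨ a = 0) n < k → k ≤ n → k ∈ S := by
    intro k hk hkn
    by_contra h
    exact Nat.findGreatest_is_greatest hk hkn (Or.inl h)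
  set a₀ := Nat.findGreatest (fun a => a ∉ S ∨ a = 0) n
  have hCa : C a₀ = δ a₀ := by
    rcases ha₀ with h | h
    · exact hCδ _ h (by omega)
    · rw [h, hC.zero, hδ.zero]
  have hex : ∃ b, n + 2 ≤ b ∧ b ≤ d ∧ C b = δ b := ⟨d, hn, le_rfl, by rw [hC.top, hδ.top]⟩
  obtain ⟨hb₁, hb₂, hb₃⟩ := Nat.find_spec hex
  have hbS : ∀ k, n + 2 ≤ k → k < Nat.find hex → k ∈ S := by
    intro k hk hkb
    by_contra h
    exact Nat.find_min hex hkb ⟨hk, by omega, hCδ k h (by omega)⟩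
  set b := Nat.find hex
  have hmid := hCδ (n + 1) hnS hn.le
  have hlow : flagWord lab δ n ≤ flagWord lab C n := by
    obtain ⟨p, hp, hp₁, hp₂⟩ := hC.exists_step hπ (n := n) (by omega)
    have hpa : p ∉ δ a₀ := fun h => hp (hC.mono ha₁ (by omega) (hCa ▸ h))
    obtain ⟨t, ht₁, ht₂, ht₃⟩ := hδ.exists_step_of_mem hπ (n := a₀) (m := n + 1) (by omega) hn.le
      (hmid ▸ hp₁ ▸ Finset.mem_insert_self _ _) hpa
    rw [hp₂, ← ht₃]
    exact ge_of_descents (m := n + 1)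
      (fun s h₁ h₂ => hdes s (by omega) (ha₂ _ (by omega) (by omega))) ht₁ (by omega) (by omega)
  have hhigh : flagWord lab C (n + 1) ≤ flagWord lab δ (n + 1) := by
    obtain ⟨q, hq, hq₁, hq₂⟩ := hC.exists_step hπ hn
    obtain ⟨t, ht₁, ht₂, ht₃⟩ := hδ.exists_step_of_mem hπ (n := n + 1) (m := b) (by omega) hb₂
      (hb₃ ▸ hC.mono (m := n + 2) hb₁ hb₂ (hq₁ ▸ Finset.mem_insert_self _ _)) (hmid ▸ hq)
    rw [hq₂, ← ht₃]
    exact ge_of_descents (fun s h₁ h₂ => hdes s (by omega) (hbS _ (by omega) h₂)) le_rfl ht₁ ht₂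
  have := hasc n hn hnS
  omega

lemma mem_mchain_iff {S : Finset ℕ} {D : List (List (Finset (Fin d)))} {j : ℕ}
    {δ : ℕ → Finset (Fin d)} (hδ : IsFlag δ) (hDj : D.getD j [] = flagList δ)
    {m : List (Finset (Fin d))} :
    m ∈ Mchain d S D j ↔
      ∃ C, IsFlag C ∧ (∀ n ∉ S, n ≤ d → C n = δ n) ∧ m = rsel d S (flagList C) := by
  rw [Mchain, Set.mem_ofPred_eq, hDj]
  constructor
  · rintro ⟨c, hc, h₁, h₂⟩
    obtain ⟨C, hC, rfl⟩ := exists_flag_of_isSatChain hc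
    exact ⟨C, hC, (rsel_compl_flagList_eq_iff hC hδ).1 h₁, h₂⟩
  · rintro ⟨C, hC, h₁, h₂⟩
    exact ⟨flagList C, isSatChain_flagList hC, (rsel_compl_flagList_eq_iff hC hδ).2 h₁, h₂⟩

/-- In a list strictly increasing along an asymmetric relation, related entries come in order. -/
lemma lt_of_pairwise_of_rel {α : Type*} {r : α → α → Prop} (hr : ∀ x y, r x y → ¬ r y x)
    {l : List α} (hl : l.Pairwise r) {j k : ℕ} (hj : j < l.length)
    (hk : k < l.length) {z : α}
    (h : r (l.getD j z) (l.getD k z)) : j < k := by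
  by_contra hcon
  rcases (not_lt.1 hcon).eq_or_lt with rfl | hkj
  · exact hr _ _ h h
  · have := List.pairwise_iff_getElem.1 hl k j hk hj hkj
    rw [← List.getD_eq_getElem _ z, ← List.getD_eq_getElem _ z] at this
    exact hr _ _ h this

section GammaFacet

variable {S : Finset ℕ} {D : List (List (Finset (Fin d)))} {i : ℕ} {δ : ℕ → Finset (Fin d)}

/-- The maximal chains with descent set `S` listed in lexicographic order. -/
structure IsDescentList (lab : Finset (Fin d) → Finset (Fin d) → ℤ) (S : Finset ℕ)
    (D : List (List (Finset (Fin d)))) : Prop where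
  mem_iff : ∀ l : List (Finset (Fin d)), l ∈ D ↔
    IsSatChain (⊥ : Finset (Fin d)) (⊤ : Finset (Fin d)) l ∧ wordDescents (chainWord lab l) = S
  pairwise : D.Pairwise fun l l' => List.Lex (· < ·) (chainWord lab l) (chainWord lab l')

lemma lex_asymm_int {v w : List ℤ} (h : List.Lex (· < ·) v w) : ¬ List.Lex (· < ·) w v :=
  fun h' => lt_asymm (List.lex_lt.1 h) (List.lex_lt.1 h')

lemma IsDescentList.exists_flag (hD : IsDescentList lab S D) (hS : S ⊆ Finset.Icc 1 (d - 1))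
    (hi : i < D.length) : ∃ δ, IsFlag δ ∧ D.getD i [] = flagList δ ∧
      ∀ n, n + 1 < d → (n + 1 ∈ S ↔ flagWord lab δ (n + 1) < flagWord lab δ n) := by
  rw [List.getD_eq_getElem _ _ hi]
  obtain ⟨h₁, h₂⟩ := (hD.mem_iff _).1 (List.getElem_mem hi)
  obtain ⟨δ, hδ, hl⟩ := exists_flag_of_isSatChain h₁
  rw [hl] at h₂
  exact ⟨δ, hδ, hl, (wordDescents_flagList_eq_iff hS).1 h₂⟩

lemma IsDescentList.exists_index (hD : IsDescentList lab S D) (hS : S ⊆ Finset.Icc 1 (d - 1))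
    (hδ : IsFlag δ)
    (hdes : ∀ n, n + 1 < d → (n + 1 ∈ S ↔ flagWord lab δ (n + 1) < flagWord lab δ n)) :
    ∃ j < D.length, D.getD j [] = flagList δ := by
  obtain ⟨j, hj, h⟩ := List.getElem_of_mem ((hD.mem_iff _).2
    ⟨isSatChain_flagList hδ, (wordDescents_flagList_eq_iff hS).2 hdes⟩)
  exact ⟨j, hj, by rw [List.getD_eq_getElem _ _ hj, h]⟩

lemma IsDescentList.index_lt (hD : IsDescentList lab S D) (hi : i < D.length)
    (hDi : D.getD i [] = flagList δ) {j : ℕ} (hj : j < D.length)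
    {δ' : ℕ → Finset (Fin d)} (hDj : D.getD j [] = flagList δ') (h : FlagLex lab δ' δ) : j < i :=
  lt_of_pairwise_of_rel (fun _ _ h => lex_asymm_int h) hD.pairwise hj hi
    (by rw [hDi, hDj]; exact lex_of_flagLex h)

/-- The increasing filling of a facet of `Γ_i` agrees with the `i`-th descent chain at all ranks
outside `S`. -/
lemma exists_flag_of_mem_gammaFacet (hπ : IsStandard lab π) (hS : S ⊆ Finset.Icc 1 (d - 1))
    (hD : IsDescentList lab S D) (hi : i < D.length) (hδ : IsFlag δ)
    (hDi : D.getD i [] = flagList δ)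
    (hdes : ∀ n, n + 1 < d → (n + 1 ∈ S ↔ flagWord lab δ (n + 1) < flagWord lab δ n))
    {e l : List (Finset (Fin d))} (he : e ∈ GammaFacet d S D i) (hl : IsUpsilon d lab e l) :
    ∃ C, IsFlag C ∧ l = flagList C ∧ e = rsel d S (flagList C) ∧
      (∀ n ∉ S, n ≤ d → C n = δ n) ∧
      ∀ n, n + 1 < d → n + 1 ∉ S → flagWord lab C n < flagWord lab C (n + 1) := by
  obtain ⟨heM, hemin⟩ := he
  obtain ⟨C', hC', hCδ', rfl⟩ := (mem_mchain_iff hδ hDi).1 heM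
  obtain ⟨hl₁, hl₂, hl₃⟩ := hl
  obtain ⟨C, hC, rfl⟩ := exists_flag_of_isSatChain hl₁
  have hCC' : ∀ n ∈ S, n ≤ d → C n = C' n := by
    intro n hn hnd
    have : C' n ∈ flagList C := hl₂.subset
      ((mem_rsel_flagList hC').2 (by rw [hC'.1 n hnd]; simp [hn]))
    rw [mem_flagList hC, hC'.1 n hnd] at this
    exact this.symm
  have hasc : ∀ n, n + 1 < d → n + 1 ∉ S → flagWord lab C n < flagWord lab C (n + 1) := by
    intro n hn hnS
    refine lt_of_le_of_ne ?_ (hC.word_ne hπ (Nat.lt_succ_self n) hn)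
    by_contra hcon
    have h₁ := hl₃ n (by simpa [chainWord_flagList] using hn) (by
      rw [chainWord_flagList, getD_map_range hn, getD_map_range (by omega)]
      exact not_le.1 hcon)
    rw [flagList_getD hn.le, mem_rsel_flagList hC', hC.1 _ hn.le] at h₁
    simp only [Finset.mem_union, hnS, Finset.mem_insert, Finset.mem_singleton,
      false_or] at h₁
    exact h₁.1.elim (Nat.succ_ne_zero n) hn.ne
  have heq : rsel d S (flagList C') = rsel d S (flagList C) :=
    ((rsel_flagList_eq_iff hC hC').2 hCC').symm
  obtain ⟨γ, hγ, hCγ, hγdes⟩ := exists_flag_descentSet hC hπ hasc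
  obtain ⟨j, hj, hDj⟩ := hD.exists_index hS hγ hγdes
  rcases eq_or_flagLex_of_descentSet hC hC' hγ hδ hπ hCC' hasc hCγ hCδ'
    (fun n hn => (hγdes n hn).1) (fun n hn => (hdes n hn).1) with h | h
  · exact ⟨C, hC, rfl, heq, fun n hn hnd => (h n hnd).trans (hCδ' n hn hnd), hasc⟩
  · exact absurd ⟨j, hD.index_lt hi hDi hj hDj h, fun x hx =>
      ⟨_, (mem_mchain_iff hγ hDj).2 ⟨C, hC, hCγ, heq⟩, hx⟩⟩ hemin

/-- A flag agreeing with the `i`-th descent chain outside `S` and ascending there yields a facet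
of `Γ_i`. -/
lemma rsel_mem_gammaFacet (hπ : IsStandard lab π) (hS : S ⊆ Finset.Icc 1 (d - 1))
    (hD : IsDescentList lab S D) (hi : i < D.length) (hδ : IsFlag δ)
    (hDi : D.getD i [] = flagList δ)
    (hdes : ∀ n, n + 1 < d → (n + 1 ∈ S ↔ flagWord lab δ (n + 1) < flagWord lab δ n))
    (hC : IsFlag C) (hCδ : ∀ n ∉ S, n ≤ d → C n = δ n)
    (hasc : ∀ n, n + 1 < d → n + 1 ∉ S → flagWord lab C n < flagWord lab C (n + 1)) :
    rsel d S (flagList C) ∈ GammaFacet d S D i := by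
  classical
  refine ⟨(mem_mchain_iff hδ hDi).2 ⟨C, hC, hCδ, rfl⟩, ?_⟩
  rintro ⟨j, hji, hj⟩
  obtain ⟨γ, hγ, hDj, hγdes⟩ := hD.exists_flag hS (hji.trans hi)
  have hthru : ∀ n ∈ S, n ≤ d → ∃ B, IsFlag B ∧ (∀ n ∉ S, n ≤ d → B n = γ n) ∧ B n = C n := by
    intro n hn hnd
    obtain ⟨m, hm, hx⟩ := hj (C n) ((mem_rsel_flagList hC).2 (by rw [hC.1 n hnd]; simp [hn]))
    obtain ⟨B, hB, hBγ, rfl⟩ := (mem_mchain_iff hγ hDj).1 hm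
    rw [mem_rsel_flagList hB, hC.1 n hnd] at hx
    exact ⟨B, hB, hBγ, hx.2.symm⟩
  have hC' : IsFlag fun n => if n ∈ S then C n else γ n := by
    refine ⟨fun n hn => ?_, fun n hn => ?_⟩
    · by_cases h : n ∈ S
      · simp [h, hC.1 n hn]
      · simp [h, hγ.1 n hn]
    · by_cases h : n ∈ S <;> by_cases h' : n + 1 ∈ S
      · simpa [h, h'] using hC.2 n hn
      · obtain ⟨B, hB, hBγ, hBC⟩ := hthru n h hn.le
        simpa [h, h', ← hBC, ← hBγ _ h' hn] using hB.2 n hn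
      · obtain ⟨B, hB, hBγ, hBC⟩ := hthru _ h' hn
        simpa [h, h', ← hBC, ← hBγ _ h hn.le] using hB.2 n hn
      · simpa [h, h'] using hγ.2 n hn
  rcases eq_or_flagLex_of_descentSet hC hC' hδ hγ hπ (fun n hn _ => by simp [hn]) hasc hCδ
    (fun n hn _ => by simp [hn]) (fun n hn => (hdes n hn).1) (fun n hn => (hγdes n hn).1)
    with h | h
  · have hδγ : ∀ n ∉ S, n ≤ d → δ n = γ n := by
      intro n hn hnd
      rw [← hCδ n hn hnd, h n hnd]
      simp [hn]
    have hkey : ∀ {α β : ℕ → Finset (Fin d)}, (∀ n ∉ S, n ≤ d → α n = β n) →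
        (∀ n, n + 1 < d → (n + 1 ∈ S ↔ flagWord lab α (n + 1) < flagWord lab α n)) →
        ∀ n, n + 1 < d → flagWord lab α n < flagWord lab α (n + 1) → α (n + 1) = β (n + 1) :=
      fun hαβ hα n hn hlt => hαβ _ (fun h => lt_asymm hlt ((hα n hn).1 h)) hn.le
    rcases eq_or_flagLex_of_agree_ascents hγ hδ hπ
      (hkey (fun n hn hnd => (hδγ n hn hnd).symm) hγdes) with h' | h'
    · have := List.pairwise_iff_getElem.1 hD.pairwise j i (hji.trans hi) hi hji
      rw [← List.getD_eq_getElem _ [], ← List.getD_eq_getElem _ [], hDi, hDj,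
        flagList_eq_iff.2 h'] at this
      exact lex_asymm_int this this
    · exact lt_asymm hji (hD.index_lt (hji.trans hi) hDj hi hDi h')
  · exact lt_asymm hji (hD.index_lt (hji.trans hi) hDj hi hDi h)

end GammaFacet

end BooleanFlag

open BooleanFlag

/-- fix an `S_d`-EL-labeling `λ` of `B_d` and `S ⊆ [d−1]`, with the
construction `D = [d_1, …, d_t]`, `L_i`, `Γ_i` as before.  Fix `i` and let
`e_1, …, e_m` (the entries of `E`) be all the maximal chains corresponding to facets of
`Γ_i`, ordered so that `λ(Υ_λ(e_k))` lexicographically precedes `λ(Υ_λ(e_j))` whenever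
`j < k`.  Then for all `j < k` there exists `j' < k` with
`e_j ∩ e_k ⊆ e_{j'} ∩ e_k = e_{j'} − x` for some `x ∈ e_{j'}`; i.e. this ordering is a
shelling of `Γ_i`. -/
theorem gamma_revlex_shelling (d : ℕ) (lab : Finset (Fin d) → Finset (Fin d) → ℤ)
    (hEL : IsSdELLabeling d lab) (S : Finset ℕ) (hS : S ⊆ Finset.Icc 1 (d - 1))
    (D : List (List (Finset (Fin d))))
    (hD : ∀ l : List (Finset (Fin d)), l ∈ D ↔
      IsSatChain (⊥ : Finset (Fin d)) (⊤ : Finset (Fin d)) l ∧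
        wordDescents (chainWord lab l) = S)
    (hDnd : D.Nodup)
    (hDlex : D.Pairwise fun l l' => List.Lex (· < ·) (chainWord lab l) (chainWord lab l'))
    (i : ℕ) (hi : i < D.length)
    (U : List (Finset (Fin d)) → List (Finset (Fin d)))
    (hU : ∀ e ∈ GammaFacet d S D i, IsUpsilon d lab e (U e))
    (E : List (List (Finset (Fin d))))
    (hE : ∀ e : List (Finset (Fin d)), e ∈ E ↔ e ∈ GammaFacet d S D i)
    (hEnd : E.Nodup)
    (hEord : E.Pairwise fun e e' =>
      List.Lex (· < ·) (chainWord lab (U e')) (chainWord lab (U e))) :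
    ∀ j k : ℕ, j < k → k < E.length →
      ∃ j' : ℕ, j' < k ∧
        (E.getD j []).toFinset ∩ (E.getD k []).toFinset ⊆
          (E.getD j' []).toFinset ∩ (E.getD k []).toFinset ∧
        ∃ x ∈ (E.getD j' []).toFinset,
          (E.getD j' []).toFinset ∩ (E.getD k []).toFinset =
            ((E.getD j' []).toFinset).erase x := by
  obtain ⟨π, hπ⟩ := exists_isStandard hEL
  have hDL : IsDescentList lab S D := ⟨hD, hDlex⟩
  obtain ⟨δ, hδ, hDi, hdes⟩ := hDL.exists_flag hS hi
  intro j k hjk hk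
  have hgetD : ∀ m < E.length, ∃ C, IsFlag C ∧ U (E.getD m []) = flagList C ∧
      E.getD m [] = rsel d S (flagList C) ∧ (∀ n ∉ S, n ≤ d → C n = δ n) ∧
      ∀ n, n + 1 < d → n + 1 ∉ S → flagWord lab C n < flagWord lab C (n + 1) := by
    intro m hm
    have he : E.getD m [] ∈ GammaFacet d S D i := by
      rw [List.getD_eq_getElem _ _ hm]
      exact (hE _).1 (List.getElem_mem hm)
    exact exists_flag_of_mem_gammaFacet hπ hS hDL hi hδ hDi hdes he (hU _ he)
  obtain ⟨A, hA, hAU, hAe, hAδ, -⟩ := hgetD j (hjk.trans hk)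
  obtain ⟨C, hC, hCU, hCe, hCδ, hCasc⟩ := hgetD k hk
  have hCA := List.pairwise_iff_getElem.1 hEord j k (hjk.trans hk) hk hjk
  rw [← List.getD_eq_getElem _ [], ← List.getD_eq_getElem _ [], hAU, hCU] at hCA
  obtain ⟨n, hn, hnS, hlt, hne⟩ : ∃ n, n + 1 < d ∧ n + 1 ∈ S ∧
      flagWord lab C n < flagWord lab C (n + 1) ∧ C (n + 1) ≠ A (n + 1) := by
    by_contra! hcon
    rcases eq_or_flagLex_of_agree_ascents hC hA hπ (fun n hn hlt => by
      by_cases hnS : n + 1 ∈ S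
      · exact hcon n hn hnS hlt
      · rw [hCδ _ hnS hn.le, hAδ _ hnS hn.le]) with h | h
    · rw [flagList_eq_iff.2 h] at hCA
      exact lex_asymm_int hCA hCA
    · exact lex_asymm_int hCA (lex_of_flagLex h)
  obtain ⟨B, hB, hBC, hBn, hw, hw'⟩ := hC.exists_swap hπ hn
  have hBδ : ∀ m ∉ S, m ≤ d → B m = δ m := by
    intro m hm hmd
    rw [hBC m (by rintro rfl; exact hm hnS), hCδ m hm hmd]
  have hBasc : ∀ m, m + 1 < d → m + 1 ∉ S → flagWord lab B m < flagWord lab B (m + 1) := by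
    intro m hm hmS
    have hsame : ∀ t, t ≠ n → t ≠ n + 1 → flagWord lab B t = flagWord lab C t := by
      intro t h₁ h₂
      rw [flagWord, flagWord, hBC t h₂, hBC (t + 1) (by omega)]
    have hCm := hCasc m hm hmS
    by_cases h₁ : m = n
    · exact absurd (h₁ ▸ hnS) hmS
    by_cases h₂ : m = n + 1
    · subst h₂
      rw [hw', hsame (n + 1 + 1) (by omega) (by omega)]
      exact hlt.trans hCm
    by_cases h₃ : m + 1 = n
    · subst h₃
      rw [hw, hsame m (by omega) (by omega)]
      exact hCm.trans hlt
    · rwa [hsame m h₁ h₂, hsame (m + 1) h₃ (by omega)]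
  obtain ⟨j', hj', hEj'⟩ := List.getElem_of_mem ((hE _).2
    (rsel_mem_gammaFacet hπ hS hDL hi hδ hDi hdes hB hBδ hBasc))
  rw [← List.getD_eq_getElem _ []] at hEj'
  obtain ⟨B', hB', hBU, hBe, hBδ', -⟩ := hgetD j' hj'
  have hBB' : flagList B' = flagList B := by
    refine flagList_eq_iff.2 fun m hm => ?_
    by_cases hmS : m ∈ S
    · exact (rsel_flagList_eq_iff hB' hB).1 (hBe.symm.trans hEj') m hmS hm
    · rw [hBδ' m hmS hm, hBδ m hmS hm]
  rw [hBB'] at hBU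
  have hmemB : ∀ x, x ∈ rsel d S (flagList B) ↔ _ := fun x => mem_rsel_flagList hB
  have hmemC : ∀ x, x ∈ rsel d S (flagList C) ↔ _ := fun x => mem_rsel_flagList hC
  have hmemA : ∀ x, x ∈ rsel d S (flagList A) ↔ _ := fun x => mem_rsel_flagList hA
  refine ⟨j', ?_, ?_, B (n + 1), ?_, ?_⟩
  · refine lt_of_pairwise_of_rel (fun _ _ h => lex_asymm_int h) hEord hj' hk (z := []) ?_
    rw [hBU, hCU]
    exact lex_of_flagLex ⟨n, by omega, fun m hm => (hBC m (by omega)).symm, by rwa [hw]⟩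
  · rw [hAe, hCe, hEj']
    intro x hx
    simp only [Finset.mem_inter, List.mem_toFinset, hmemA, hmemB, hmemC] at hx ⊢
    refine ⟨⟨hx.2.1, ?_⟩, hx.2⟩
    have hxn : x.card ≠ n + 1 := fun h => hne (by rw [← h, ← hx.2.2, ← hx.1.2])
    rw [hBC _ hxn]
    exact hx.2.2
  · rw [hEj', List.mem_toFinset, hmemB, hB.1 _ hn.le]
    simp [hnS]
  · rw [hCe, hEj']
    ext x
    simp only [Finset.mem_inter, List.mem_toFinset, hmemB, hmemC, Finset.mem_erase]
    constructor
    · rintro ⟨h₁, h₂⟩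
      refine ⟨?_, h₁⟩
      rintro rfl
      rw [hB.1 _ hn.le] at h₂
      exact hBn h₂.2
    · rintro ⟨h₁, h₂⟩
      refine ⟨h₂, h₂.1, ?_⟩
      have hxn : x.card ≠ n + 1 := fun h => h₁ (by rw [← h]; exact h₂.2)
      rw [← hBC _ hxn]
      exact h₂.2
end
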